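/- Let K ⊂ ℝⁿ be a convex body of class C²₊ and let α > 0 be such that all principal curvatures of ∂K are greater than or equal to α at every point. Then for every ψ ∈ C¹(∂K) with ∫_{∂K} ψ dℋ^{n-1} = 0, one has (n-1) α² ∫_{∂K} ψ² dℋ^{n-1} ≤ ∫_{∂K} |∇ψ|² dℋ^{n-1}. -/

import Mathlib

open MeasureTheory Metric
open scoped RealInnerProductSpace ENNReal

noncomputable section

/-- Euclidean `n`-space. -/
abbrev E (n : ℕ) : Type := EuclideanSpace ℝ (Fin n)

/-- Orthogonal projection onto the hyperplane orthogonal to the unit vector `u`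
(the tangent space at a boundary point with outer unit normal `u`). -/
noncomputable def tproj {n : ℕ} (u : E n) : E n →L[ℝ] E n :=
  ContinuousLinearMap.id ℝ (E n) - (innerSL ℝ u).smulRight u

section

open Filter Topology

lemma volume_add_volume_le_of_isCompact {A B : Set ℝ} (hA : IsCompact A) (hB : IsCompact B)
    (hA' : A.Nonempty) (hB' : B.Nonempty) {C : Set ℝ}
    (h : ∀ a ∈ A, ∀ b ∈ B, (a + b) / 2 ∈ C) :
    volume A + volume B ≤ 2 * volume C := by
  obtain ⟨M, hM⟩ := hA.exists_isGreatest hA'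
  obtain ⟨m, hm⟩ := hB.exists_isLeast hB'
  have hsub : (fun x => x + m) '' A ∪ (fun x => M + x) '' B ⊆ (fun x : ℝ => 2 * x) '' C := by
    rintro z (⟨x, hx, rfl⟩ | ⟨x, hx, rfl⟩)
    · exact ⟨(x + m) / 2, h x hx m hm.1, by ring⟩
    · exact ⟨(M + x) / 2, h M hM.1 x hx, by ring⟩
  have hae : AEDisjoint volume ((fun x => x + m) '' A) ((fun x => M + x) '' B) := by
    refine measure_mono_null (t := {M + m}) ?_ (by simp)
    rintro z ⟨⟨x, hx, rfl⟩, ⟨y, hy, hxy⟩⟩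
    have h1 := hM.2 hx
    have h2 := hm.2 hy
    simp only [Set.mem_singleton_iff] at *
    linarith
  have hBm : NullMeasurableSet ((fun x => M + x) '' B) volume :=
    (hB.image (by fun_prop)).measurableSet.nullMeasurableSet
  calc volume A + volume B
      = volume ((fun x => x + m) '' A) + volume ((fun x => M + x) '' B) := by simp
    _ = volume ((fun x => x + m) '' A ∪ (fun x => M + x) '' B) :=
        (measure_union₀ hBm hae).symm
    _ ≤ volume ((fun x : ℝ => 2 * x) '' C) := measure_mono hsub
    _ = 2 * volume C := by
        have := Measure.addHaar_smul (volume : Measure ℝ) 2 C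
        rw [← Set.image_smul] at this
        simpa using this

lemma volume_add_volume_le_two_mul {A B : Set ℝ} (hA : MeasurableSet A) (hB : MeasurableSet B)
    (hA' : A.Nonempty) (hB' : B.Nonempty) {C : Set ℝ}
    (h : ∀ a ∈ A, ∀ b ∈ B, (a + b) / 2 ∈ C) :
    volume A + volume B ≤ 2 * volume C := by
  obtain ⟨a₀, ha₀⟩ := hA'
  obtain ⟨b₀, hb₀⟩ := hB'
  rw [hA.measure_eq_iSup_isCompact, hB.measure_eq_iSup_isCompact]
  simp only [iSup_and']
  refine ENNReal.biSup_add_biSup_le' (p := fun K => K ⊆ A ∧ IsCompact K)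
    (q := fun K => K ⊆ B ∧ IsCompact K) ⟨∅, by simp⟩ ⟨∅, by simp⟩ ?_
  rintro K ⟨hKA, hK⟩ L ⟨hLB, hL⟩
  calc volume K + volume L ≤ volume (insert a₀ K) + volume (insert b₀ L) := by
        gcongr <;> exact Set.subset_insert _ _
    _ ≤ _ := volume_add_volume_le_of_isCompact (hK.insert _) (hL.insert _) (by simp) (by simp)
        fun a ha b hb => h a (Set.insert_subset ha₀ hKA ha) b (Set.insert_subset hb₀ hLB hb)

/-- One-dimensional Prékopa–Leindler (midpoint) inequality, for functions with supremum one. -/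
lemma lintegral_add_lintegral_le {f g h : ℝ → ℝ≥0∞} (hf : Measurable f) (hg : Measurable g)
    (hh : Measurable h) (hf1 : ⨆ x, f x = 1) (hg1 : ⨆ x, g x = 1)
    (H : ∀ x y, f x * g y ≤ h ((x + y) / 2) ^ 2) :
    (∫⁻ x, f x) + ∫⁻ x, g x ≤ 2 * ∫⁻ x, h x := by
  have key : ∀ k : ℝ → ℝ≥0∞, Measurable k → (∀ x, k x ≤ 1) →
      ∫⁻ x, k x = ∫⁻ t in Set.Ioo (0 : ℝ) 1, volume {x | ENNReal.ofReal t < k x} := by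
    intro k hk hk1
    have h1 : ∫⁻ x, k x = ∫⁻ x, ENNReal.ofReal ((k x).toReal) := by
      refine lintegral_congr fun x => ?_
      rw [ENNReal.ofReal_toReal (ne_top_of_le_ne_top ENNReal.one_ne_top (hk1 x))]
    have h2 := lintegral_eq_lintegral_meas_lt (volume : Measure ℝ) (f := fun x => (k x).toReal)
      (Filter.Eventually.of_forall fun x => ENNReal.toReal_nonneg) hk.ennreal_toReal.aemeasurable
    rw [h1, h2, ← lintegral_indicator measurableSet_Ioi, ← lintegral_indicator measurableSet_Ioo]
    refine lintegral_congr_ae ?_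
    have : ∀ᵐ t : ℝ, t ≠ 1 := by simp [ae_iff]
    filter_upwards [this] with t ht
    have e : ∀ x, 0 < t → (t < (k x).toReal ↔ ENNReal.ofReal t < k x) := fun x h0 =>
      (ENNReal.ofReal_lt_iff_lt_toReal h0.le
        (ne_top_of_le_ne_top ENNReal.one_ne_top (hk1 x))).symm
    by_cases h0 : 0 < t
    · by_cases h1 : t < 1
      · simp [Set.indicator, h0, h1, e]
      · have : ∀ x, ¬ (ENNReal.ofReal t < k x) := by
          intro x hx
          rw [← e x h0] at hx
          have h3 : (k x).toReal ≤ 1 := ENNReal.toReal_mono ENNReal.one_ne_top (hk1 x)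
          exact h1 (by linarith)
        simp [Set.indicator, h0, h1, e, this]
    · simp [Set.indicator, h0]
  have hfl : ∀ x, f x ≤ 1 := fun x => hf1 ▸ le_iSup f x
  have hgl : ∀ x, g x ≤ 1 := fun x => hg1 ▸ le_iSup g x
  have hm : ∀ k : ℝ → ℝ≥0∞, Measurable (fun t : ℝ => volume {x | ENNReal.ofReal t < k x}) := by
    intro k
    refine Antitone.measurable fun s t hst => measure_mono fun x hx => ?_
    exact lt_of_le_of_lt (ENNReal.ofReal_le_ofReal hst) hx
  calc (∫⁻ x, f x) + ∫⁻ x, g x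
      = ∫⁻ t in Set.Ioo (0 : ℝ) 1, (volume {x | ENNReal.ofReal t < f x}
          + volume {x | ENNReal.ofReal t < g x}) := by
        rw [key f hf hfl, key g hg hgl, lintegral_add_left (hm f)]
    _ ≤ ∫⁻ t in Set.Ioo (0 : ℝ) 1, 2 * volume {x | ENNReal.ofReal t < min (h x) 1} := by
        refine setLIntegral_mono' measurableSet_Ioo fun t ht => ?_
        have ht1 : ENNReal.ofReal t < 1 := by
          rw [← ENNReal.ofReal_one]; exact (ENNReal.ofReal_lt_ofReal_iff one_pos).2 ht.2
        refine volume_add_volume_le_two_mul (measurableSet_lt measurable_const hf)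
          (measurableSet_lt measurable_const hg) ?_ ?_ ?_
        · exact lt_iSup_iff.1 (hf1 ▸ ht1)
        · exact lt_iSup_iff.1 (hg1 ▸ ht1)
        · intro a ha b hb
          simp only [Set.mem_ofPred_eq, lt_min_iff] at *
          refine ⟨?_, ht1⟩
          have := (ENNReal.mul_lt_mul ha hb).trans_le (H a b)
          rw [← sq] at this
          exact lt_of_not_ge fun hle => this.not_ge (pow_le_pow_left' hle 2)
    _ = 2 * ∫⁻ x, min (h x) 1 := by
        rw [lintegral_const_mul _ (hm _), key _ (hh.min measurable_const) (fun x => min_le_right _ _)]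
    _ ≤ 2 * ∫⁻ x, h x := by
        gcongr with x
        exact min_le_left _ _

lemma ennreal_mul_le_sq_of_add_le {a b c : ℝ≥0∞} (h : a + b ≤ 2 * c) : a * b ≤ c ^ 2 := by
  by_cases hc : c = ∞
  · simp [hc]
  have hab : a + b ≠ ∞ := ne_top_of_le_ne_top (by finiteness) h
  have ha : a ≠ ∞ := fun h => hab (by simp [h])
  have hb : b ≠ ∞ := fun h => hab (by simp [h])
  lift a to NNReal using ha
  lift b to NNReal using hb
  lift c to NNReal using hc
  norm_cast at h ⊢
  rw [← NNReal.coe_le_coe] at h ⊢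
  push_cast at h ⊢
  nlinarith [sq_nonneg ((a : ℝ) - b), a.coe_nonneg, b.coe_nonneg, c.coe_nonneg]

/-- One-dimensional Prékopa–Leindler (midpoint) inequality. -/
lemma lintegral_mul_lintegral_le_real {f g h : ℝ → ℝ≥0∞} (hf : Measurable f) (hg : Measurable g)
    (hh : Measurable h) (H : ∀ x y, f x * g y ≤ h ((x + y) / 2) ^ 2) :
    (∫⁻ x, f x) * ∫⁻ x, g x ≤ (∫⁻ x, h x) ^ 2 := by
  have bdd : ∀ {f g : ℝ → ℝ≥0∞}, Measurable f → Measurable g → (⨆ x, f x ≠ ∞) → (⨆ x, g x ≠ ∞) →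
      (∀ x y, f x * g y ≤ h ((x + y) / 2) ^ 2) →
      (∫⁻ x, f x) * ∫⁻ x, g x ≤ (∫⁻ x, h x) ^ 2 := by
    intro f g hf hg hft hgt H
    set a := ⨆ x, f x with ha
    set b := ⨆ x, g x with hb
    by_cases ha0 : a = 0
    · have : ∀ x, f x = 0 := fun x => le_antisymm (ha0 ▸ le_iSup f x) zero_le
      simp [this]
    by_cases hb0 : b = 0
    · have : ∀ x, g x = 0 := fun x => le_antisymm (hb0 ▸ le_iSup g x) zero_le
      simp [this]
    obtain ⟨c, hc⟩ : ∃ c : ℝ≥0∞, c ^ 2 = a * b := by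
      refine ⟨(a * b) ^ (1 / 2 : ℝ), ?_⟩
      rw [← ENNReal.rpow_natCast, ← ENNReal.rpow_mul]; norm_num
    have hab0 : a * b ≠ 0 := mul_ne_zero ha0 hb0
    have habt : a * b ≠ ∞ := ENNReal.mul_ne_top hft hgt
    have hc0 : c ≠ 0 := by rintro rfl; simp at hc; exact hab0 (by simpa [or_comm] using hc.symm)
    have hct : c ≠ ∞ := by rintro rfl; simp at hc; exact habt hc.symm
    have := lintegral_add_lintegral_le (f := fun x => a⁻¹ * f x) (g := fun x => b⁻¹ * g x)
      (h := fun x => c⁻¹ * h x) (hf.const_mul _) (hg.const_mul _) (hh.const_mul _)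
      (by rw [← ENNReal.mul_iSup, ENNReal.inv_mul_cancel ha0 hft])
      (by rw [← ENNReal.mul_iSup, ENNReal.inv_mul_cancel hb0 hgt]) ?_
    · have := ennreal_mul_le_sq_of_add_le this
      rw [lintegral_const_mul _ hf, lintegral_const_mul _ hg, lintegral_const_mul _ hh,
        mul_mul_mul_comm, mul_pow, ← ENNReal.mul_inv (Or.inl ha0) (Or.inl hft),
        ← ENNReal.inv_pow, hc] at this
      exact (ENNReal.mul_le_mul_iff_right (ENNReal.inv_ne_zero.2 habt)
        (ENNReal.inv_ne_top.2 hab0)).1 this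
    · intro x y
      rw [mul_mul_mul_comm, mul_pow, ← ENNReal.mul_inv (Or.inl ha0) (Or.inl hft),
        ← ENNReal.inv_pow, hc]
      gcongr
      exact H x y
  have trunc : ∀ k : ℝ → ℝ≥0∞, Measurable k →
      ∫⁻ x, k x = ⨆ N : ℕ, ∫⁻ x, min (k x) N := by
    intro k hk
    rw [← lintegral_iSup (fun N => hk.min measurable_const)]
    · refine lintegral_congr fun x => ?_
      refine le_antisymm ?_ (iSup_le fun N => min_le_left _ _)
      refine le_of_forall_lt fun y hy => ?_
      obtain ⟨N, hN⟩ := ENNReal.exists_nat_gt (ne_top_of_lt hy)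
      exact lt_iSup_iff.2 ⟨N, lt_min hy hN⟩
    · intro N M hNM x
      exact min_le_min le_rfl (by exact_mod_cast hNM)
  rw [trunc f hf, trunc g hg, ENNReal.iSup_mul]
  refine iSup_le fun N => ?_
  rw [ENNReal.mul_iSup]
  refine iSup_le fun M => bdd (hf.min measurable_const) (hg.min measurable_const) ?_ ?_ ?_
  · exact ne_top_of_le_ne_top (ENNReal.natCast_ne_top N) (iSup_le fun x => min_le_right _ _)
  · exact ne_top_of_le_ne_top (ENNReal.natCast_ne_top M) (iSup_le fun x => min_le_right _ _)
  · intro x y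
    exact (mul_le_mul' (min_le_left _ _) (min_le_left _ _)).trans (H x y)

/-- Prékopa–Leindler (midpoint) inequality on `Fin n → ℝ`. -/
lemma lintegral_mul_lintegral_le_pi (n : ℕ) {f g h : (Fin n → ℝ) → ℝ≥0∞} (hf : Measurable f)
    (hg : Measurable g) (hh : Measurable h)
    (H : ∀ x y, f x * g y ≤ h ((2⁻¹ : ℝ) • (x + y)) ^ 2) :
    (∫⁻ x, f x) * ∫⁻ x, g x ≤ (∫⁻ x, h x) ^ 2 := by
  induction n with
  | zero =>
    have : ∀ k : (Fin 0 → ℝ) → ℝ≥0∞, ∫⁻ x, k x = k 0 := by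
      intro k
      rw [volume_pi, Measure.pi_of_empty _ 0, lintegral_dirac]
    simpa [this] using H 0 0
  | succ n ih =>
    let e := MeasurableEquiv.piFinSuccAbove (fun _ : Fin (n + 1) => ℝ) 0
    have he : ∀ k : (Fin (n + 1) → ℝ) → ℝ≥0∞, Measurable k →
        ∫⁻ x, k x = ∫⁻ s : ℝ, ∫⁻ y : Fin n → ℝ, k (Fin.cons s y) := by
      intro k hk
      rw [← (volume_preserving_piFinSuccAbove (fun _ : Fin (n + 1) => ℝ) 0).symm.lintegral_comp hk]
      rw [Measure.volume_eq_prod, lintegral_prod _ (by fun_prop)]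
      simp [MeasurableEquiv.piFinSuccAbove, Fin.insertNthEquiv]
    have hc : Measurable (fun p : ℝ × (Fin n → ℝ) => (Fin.cons p.1 p.2 : Fin (n + 1) → ℝ)) := by
      refine measurable_pi_iff.2 fun i => ?_
      refine Fin.cases ?_ (fun j => ?_) i
      · simpa using measurable_fst
      · simpa [Function.comp_def] using (measurable_pi_apply j).comp (measurable_snd (α := ℝ))
    have hm : ∀ {k : (Fin (n + 1) → ℝ) → ℝ≥0∞}, Measurable k →
        Measurable (fun s : ℝ => ∫⁻ y : Fin n → ℝ, k (Fin.cons s y)) := fun hk =>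
      (hk.comp hc).lintegral_prod_right'
    have hs : ∀ {k : (Fin (n + 1) → ℝ) → ℝ≥0∞}, Measurable k → ∀ s : ℝ,
        Measurable (fun y : Fin n → ℝ => k (Fin.cons s y)) := fun hk s =>
      (hk.comp hc).comp measurable_prodMk_left
    rw [he f hf, he g hg, he h hh]
    refine lintegral_mul_lintegral_le_real (hm hf) (hm hg) (hm hh) fun s r => ?_
    refine ih (hs hf s) (hs hg r) (hs hh _) fun x y => ?_
    convert H (Fin.cons s x) (Fin.cons r y) using 3
    ext i
    refine Fin.cases ?_ (fun j => ?_) i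
    · simp; ring
    · simp; ring

/-- Multiplicative Brunn–Minkowski inequality for midpoints of compact sets. -/
lemma volume_mul_volume_le_sq {n : ℕ} {A B C : Set (E n)} (hA : MeasurableSet A)
    (hB : MeasurableSet B) (hC : MeasurableSet C)
    (H : ∀ a ∈ A, ∀ b ∈ B, (2⁻¹ : ℝ) • (a + b) ∈ C) :
    volume A * volume B ≤ volume C ^ 2 := by
  have hv := (EuclideanSpace.volume_preserving_symm_measurableEquiv_toLp (Fin n)).symm
  have key : ∀ S : Set (E n), MeasurableSet S →
      volume S = ∫⁻ x : Fin n → ℝ, S.indicator 1 (WithLp.toLp 2 x) := by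
    intro S hS
    rw [← lintegral_indicator_one hS, ← hv.lintegral_comp (measurable_one.indicator hS)]
    rfl
  have hmeas : ∀ S : Set (E n), MeasurableSet S →
      Measurable (fun x : Fin n → ℝ => S.indicator (1 : E n → ℝ≥0∞) (WithLp.toLp 2 x)) :=
    fun S hS => (measurable_one.indicator hS).comp hv.measurable
  rw [key A hA, key B hB, key C hC]
  refine lintegral_mul_lintegral_le_pi n (hmeas A hA) (hmeas B hB) (hmeas C hC) fun x y => ?_
  by_cases hx : WithLp.toLp 2 x ∈ A
  · by_cases hy : WithLp.toLp 2 y ∈ B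
    · have : WithLp.toLp 2 ((2⁻¹ : ℝ) • (x + y)) ∈ C := H _ hx _ hy
      rw [Set.indicator_of_mem this]
      simp [hx, hy]
    · simp [hy]
  · simp [hx]

/-- The isometric embedding of `E k` as the hyperplane of points with first coordinate `s`. -/
def consEmb {k : ℕ} (s : ℝ) (y : E k) : E (k + 1) := WithLp.toLp 2 (Fin.cons s y.ofLp)

lemma isometry_consEmb {k : ℕ} (s : ℝ) : Isometry (consEmb (k := k) s) := by
  refine Isometry.of_dist_eq fun x y => ?_
  simp [EuclideanSpace.dist_eq, consEmb, Fin.sum_univ_succ]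

lemma volume_eq_lintegral_consEmb {k : ℕ} {Y : Set (E (k + 1))} (hY : MeasurableSet Y) :
    volume Y = ∫⁻ s : ℝ, volume (consEmb (k := k) s ⁻¹' Y) := by
  have hv := fun n => (EuclideanSpace.volume_preserving_symm_measurableEquiv_toLp (Fin n)).symm
  have hm : ∀ s, Measurable (consEmb (k := k) s) := fun s => (isometry_consEmb s).continuous.measurable
  have h1 : volume Y = volume ((WithLp.toLp 2 : (Fin (k+1) → ℝ) → E (k+1)) ⁻¹' Y) :=
    ((hv (k + 1)).measure_preimage hY.nullMeasurableSet).symm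
  have hY' : MeasurableSet ((WithLp.toLp 2 : (Fin (k+1) → ℝ) → E (k+1)) ⁻¹' Y) :=
    (hv (k + 1)).measurable hY
  have h2 := (volume_preserving_piFinSuccAbove (fun _ : Fin (k + 1) => ℝ) 0).symm.measure_preimage
    hY'.nullMeasurableSet
  have hY'' := (volume_preserving_piFinSuccAbove (fun _ : Fin (k + 1) => ℝ) 0).symm.measurable hY'
  rw [h1, ← h2, Measure.volume_eq_prod, Measure.prod_apply hY'']
  refine lintegral_congr fun s => ?_
  rw [← (hv k).measure_preimage (hm s hY).nullMeasurableSet]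
  congr 1
  ext y
  simp [consEmb, MeasurableEquiv.piFinSuccAbove, Fin.insertNthEquiv, MeasurableEquiv.toLp]
  rfl

/-- Slicing of Lebesgue measure by parallel hyperplanes, in terms of the Hausdorff measure of
the slices. -/
lemma exists_volume_eq_lintegral_hausdorffMeasure {n : ℕ} (hn : 1 ≤ n) :
    ∃ c : ℝ≥0∞, c ≠ 0 ∧ c ≠ ∞ ∧ ∀ u : E n, ‖u‖ = 1 → ∀ Y : Set (E n), MeasurableSet Y →
      volume Y = c * ∫⁻ s : ℝ, μH[(n : ℝ) - 1] (Y ∩ {y | ⟪u, y⟫ = s}) := by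
  obtain ⟨k, rfl⟩ : ∃ k, n = k + 1 := ⟨n - 1, by omega⟩
  have hfr : (Module.finrank ℝ (E k) : ℝ) = k := by simp
  have hk : ((k + 1 : ℕ) : ℝ) - 1 = k := by simp
  have : (μH[(k : ℝ)] : Measure (E k)).IsAddHaarMeasure := by
    rw [← hfr]; infer_instance
  set c := Measure.addHaarScalarFactor (volume : Measure (E k)) μH[(k : ℝ)] with hc
  have hcs : (volume : Measure (E k)) = c • μH[(k : ℝ)] :=
    Measure.isAddLeftInvariant_eq_smul _ _
  refine ⟨c, ?_, ENNReal.coe_ne_top, ?_⟩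
  · rw [ENNReal.coe_ne_zero]
    exact (Measure.addHaarScalarFactor_pos_of_isAddHaarMeasure _ _).ne'
  intro u hu Y hY
  rw [hk]
  obtain ⟨b, hb⟩ := Orthonormal.exists_orthonormalBasis_extension_of_card_eq
    (𝕜 := ℝ) (E := E (k + 1)) (ι := Fin (k + 1)) (by simp) (v := fun _ => u) (s := {0}) (by
      rw [orthonormal_iff_ite]
      rintro ⟨i, hi⟩ ⟨j, hj⟩
      simp only [Set.mem_singleton_iff] at hi hj
      subst hi; subst hj
      simp [hu])
  have hb0 : b 0 = u := hb 0 rfl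
  have hY' : MeasurableSet (b.repr.symm ⁻¹' Y) := b.repr.symm.continuous.measurable hY
  have hm : ∀ s, Measurable (consEmb (k := k) s) := fun s => (isometry_consEmb s).continuous.measurable
  rw [← b.repr.symm.measurePreserving.measure_preimage hY.nullMeasurableSet,
    volume_eq_lintegral_consEmb hY', ← lintegral_const_mul']
  swap; · exact ENNReal.coe_ne_top
  refine lintegral_congr fun s => ?_
  have hset : Y ∩ {y | ⟪u, y⟫ = s} =
      (b.repr.symm ∘ consEmb s) '' (consEmb (k := k) s ⁻¹' (b.repr.symm ⁻¹' Y)) := by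
    ext y
    constructor
    · rintro ⟨hy, hs⟩
      have e : consEmb s (WithLp.toLp 2 (Fin.tail (b.repr y).ofLp)) = b.repr y := by
        ext i
        refine Fin.cases ?_ (fun j => ?_) i
        · have hs' : ⟪u, y⟫ = s := hs
          simp [consEmb, ← hs', ← hb0, b.repr_apply_apply]
        · simp [consEmb, Fin.tail]
      refine ⟨WithLp.toLp 2 (Fin.tail (b.repr y).ofLp), ?_, ?_⟩
      · simp only [Set.mem_preimage, e]; simpa using hy
      · simp [e]
    · rintro ⟨x, hx, rfl⟩
      refine ⟨hx, ?_⟩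
      have : ⟪u, (b.repr.symm ∘ consEmb s) x⟫ = consEmb s x 0 := by
        rw [← hb0, ← b.repr_apply_apply]
        simp
      simp only [Set.mem_ofPred_eq, this]
      simp [consEmb]
  rw [hset, Isometry.hausdorffMeasure_image (b.repr.symm.isometry.comp (isometry_consEmb s))
    (Or.inl (by positivity)), hcs]
  simp

lemma tproj_apply {n : ℕ} (u x : E n) : tproj u x = x - ⟪u, x⟫ • u := by
  simp [tproj]

lemma inner_tproj {n : ℕ} {u : E n} (hu : ‖u‖ = 1) (x : E n) : ⟪u, tproj u x⟫ = 0 := by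
  simp [tproj_apply, inner_sub_right, inner_smul_right, hu]

lemma tproj_tproj {n : ℕ} {u : E n} (hu : ‖u‖ = 1) (x : E n) :
    tproj u (tproj u x) = tproj u x := by
  rw [tproj_apply u (tproj u x), inner_tproj hu]; simp

lemma tproj_self {n : ℕ} {u : E n} (hu : ‖u‖ = 1) : tproj u u = 0 := by
  simp [tproj_apply, hu]

lemma norm_tproj_add_sq {n : ℕ} {u : E n} (hu : ‖u‖ = 1) (x : E n) (s : ℝ) :
    ‖tproj u x + s • u‖ ^ 2 = ‖tproj u x‖ ^ 2 + s ^ 2 := by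
  rw [norm_add_sq_real, inner_smul_right, real_inner_comm, inner_tproj hu, norm_smul, hu]
  simp

lemma norm_sq_eq_tproj {n : ℕ} {u : E n} (hu : ‖u‖ = 1) (x : E n) :
    ‖x‖ ^ 2 = ‖tproj u x‖ ^ 2 + ⟪u, x⟫ ^ 2 := by
  rw [← norm_tproj_add_sq hu]; simp [tproj_apply]

lemma norm_tproj_le {n : ℕ} {u : E n} (hu : ‖u‖ = 1) (x : E n) : ‖tproj u x‖ ≤ ‖x‖ := by
  refine abs_le_of_sq_le_sq' ?_ (norm_nonneg _) |>.2
  nlinarith [norm_sq_eq_tproj hu x, sq_nonneg ⟪u, x⟫]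

lemma exists_ball_of_eventually_prod {X : Type*} [PseudoMetricSpace X] {x₀ : X}
    {P : X × X → Prop} (h : ∀ᶠ p in 𝓝 (x₀, x₀), P p) :
    ∃ r > 0, ∀ x ∈ ball x₀ r, ∀ y ∈ ball x₀ r, P (x, y) := by
  obtain ⟨r, hr, H⟩ := Metric.eventually_nhds_iff.1 h
  exact ⟨r, hr, fun x hx y hy => H (max_lt hx hy)⟩

/-- A convex body with a unit outer normal field `ν` which extends to a `C¹` field on a
neighbourhood `U` of the boundary. -/
structure IsSmoothBody {n : ℕ} (K : Set (E n)) (ν : E n → E n) (U : Set (E n)) : Prop where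
  conv : Convex ℝ K
  comp : IsCompact K
  int : (interior K).Nonempty
  isOpen : IsOpen U
  sub : frontier K ⊆ U
  smooth : ContDiffOn ℝ 1 ν U
  unit : ∀ x ∈ frontier K, ‖ν x‖ = 1
  outer : ∀ x ∈ frontier K, ∀ y ∈ K, ⟪y - x, ν x⟫ ≤ 0

/-- Normal coordinates: the point at height `p.2` above `p.1` in the direction `ν p.1`. -/
def tube {n : ℕ} (ν : E n → E n) (p : E n × ℝ) : E n := p.1 + p.2 • ν p.1

/-- The Weingarten map at `x`, extended by zero to the normal direction. -/
def shape {n : ℕ} (ν : E n → E n) (x : E n) : E n →L[ℝ] E n :=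
  (fderiv ℝ ν x).comp (tproj (ν x))

/-- The Jacobian of the normal coordinates. -/
def jac {n : ℕ} (ν : E n → E n) (p : E n × ℝ) : ℝ :=
  |(ContinuousLinearMap.id ℝ (E n) + p.2 • shape ν p.1).det|

namespace IsSmoothBody

variable {n : ℕ} {K : Set (E n)} {ν : E n → E n} {U : Set (E n)}

lemma frontier_subset (h : IsSmoothBody K ν U) : frontier K ⊆ K :=
  h.comp.isClosed.frontier_subset

lemma isCompact_frontier (h : IsSmoothBody K ν U) : IsCompact (frontier K) :=
  h.comp.of_isClosed_subset isClosed_frontier h.frontier_subset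

lemma continuousOn (h : IsSmoothBody K ν U) : ContinuousOn ν (frontier K) :=
  h.smooth.continuousOn.mono h.sub

lemma continuousOn_fderiv (h : IsSmoothBody K ν U) : ContinuousOn (fderiv ℝ ν) (frontier K) :=
  (h.smooth.continuousOn_fderiv_of_isOpen h.isOpen le_rfl).mono h.sub

lemma hasStrictFDerivAt (h : IsSmoothBody K ν U) {x : E n} (hx : x ∈ frontier K) :
    HasStrictFDerivAt ν (fderiv ℝ ν x) x :=
  (h.smooth.contDiffAt (h.isOpen.mem_nhds (h.sub hx))).hasStrictFDerivAt one_ne_zero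

lemma continuousOn_tube (h : IsSmoothBody K ν U) :
    ContinuousOn (tube ν) (frontier K ×ˢ Set.univ) :=
  continuousOn_fst.add (continuousOn_snd.smul
    (h.continuousOn.comp continuousOn_fst fun _ hp => hp.1))

lemma continuousOn_tproj (h : IsSmoothBody K ν U) :
    ContinuousOn (fun x => tproj (ν x)) (frontier K) := by
  have : Continuous fun u : E n => tproj u := by
    unfold tproj
    refine continuous_const.sub ?_
    exact ((ContinuousLinearMap.smulRightL ℝ (E n) (E n)).continuous₂.comp
      ((innerSL ℝ).continuous.prodMk continuous_id))
  exact this.comp_continuousOn h.continuousOn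

lemma continuousOn_shape (h : IsSmoothBody K ν U) : ContinuousOn (shape ν) (frontier K) :=
  h.continuousOn_fderiv.clm_comp h.continuousOn_tproj

lemma continuousOn_jac (h : IsSmoothBody K ν U) :
    ContinuousOn (jac ν) (frontier K ×ˢ Set.univ) := by
  refine (ContinuousLinearMap.continuous_det.comp_continuousOn ?_).abs
  exact continuousOn_const.add (continuousOn_snd.smul
    (h.continuousOn_shape.comp continuousOn_fst fun _ hp => hp.1))

lemma inner_sub_nonneg (h : IsSmoothBody K ν U) {x y : E n} (hx : x ∈ frontier K) (hy : y ∈ K) :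
    0 ≤ ⟪x - y, ν x⟫ := by
  have := h.outer x hx y hy
  rw [← neg_sub, inner_neg_left] at this
  linarith

lemma norm_sub_le_tube (h : IsSmoothBody K ν U) {p q : E n × ℝ} (hp : p ∈ frontier K ×ˢ Set.Ici 0)
    (hq : q ∈ frontier K ×ˢ Set.Ici (0 : ℝ)) : ‖p.1 - q.1‖ ≤ ‖tube ν p - tube ν q‖ := by
  obtain ⟨x, s⟩ := p
  obtain ⟨y, r⟩ := q
  obtain ⟨hx, hs : 0 ≤ s⟩ := hp
  obtain ⟨hy, hr : 0 ≤ r⟩ := hq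
  simp only at hx hy ⊢
  have h1 := h.inner_sub_nonneg hx (h.frontier_subset hy)
  have h2 := h.outer y hy x (h.frontier_subset hx)
  have h3 : ⟪x - y, tube ν (x, s) - tube ν (y, r)⟫
      = ‖x - y‖ ^ 2 + s * ⟪x - y, ν x⟫ - r * ⟪x - y, ν y⟫ := by
    have : tube ν (x, s) - tube ν (y, r) = (x - y) + s • ν x - r • ν y := by
      simp [tube]; abel
    rw [this, inner_sub_right, inner_add_right, inner_smul_right, inner_smul_right,
      real_inner_self_eq_norm_sq]
  have h4 := real_inner_le_norm (x - y) (tube ν (x, s) - tube ν (y, r))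
  by_contra! hlt
  have h5 : 0 < ‖x - y‖ := (norm_nonneg _).trans_lt hlt
  nlinarith [mul_nonneg hs h1, mul_nonneg hr (neg_nonneg.2 h2)]

lemma injOn_tube (h : IsSmoothBody K ν U) :
    Set.InjOn (tube ν) (frontier K ×ˢ Set.Ici (0 : ℝ)) := by
  rintro ⟨x, s⟩ hp ⟨y, r⟩ hq hpq
  have h1 := h.norm_sub_le_tube hp hq
  rw [hpq] at h1
  simp only [sub_self, norm_zero, norm_le_zero_iff, sub_eq_zero] at h1
  subst h1
  have h2 : s • ν x = r • ν x := by simpa [tube] using hpq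
  have h3 : ν x ≠ 0 := by
    intro h0; have := h.unit x hp.1; simp [h0] at this
  rw [smul_left_injective ℝ h3 h2]

lemma tube_notMem (h : IsSmoothBody K ν U) {x : E n} {s : ℝ} (hx : x ∈ frontier K) (hs : 0 < s) :
    tube ν (x, s) ∉ K := by
  intro hm
  have := h.outer x hx _ hm
  simp [tube, inner_smul_left, h.unit x hx] at this
  linarith

lemma abs_inner_sub_le (h : IsSmoothBody K ν U) {x₀ x y : E n} {ε : ℝ} (hx : x ∈ frontier K)
    (hy : y ∈ frontier K) (hxε : ‖ν x - ν x₀‖ ≤ ε) (hyε : ‖ν y - ν x₀‖ ≤ ε) :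
    |⟪ν x₀, x - y⟫| ≤ ε * ‖x - y‖ := by
  have h1 := h.inner_sub_nonneg hx (h.frontier_subset hy)
  have h2 := h.outer y hy x (h.frontier_subset hx)
  have h3 := abs_le.1 (abs_real_inner_le_norm (x - y) (ν x - ν x₀))
  have h4 := abs_le.1 (abs_real_inner_le_norm (x - y) (ν y - ν x₀))
  rw [inner_sub_right] at h3 h4
  rw [real_inner_comm, abs_le]
  have h5 := mul_le_mul_of_nonneg_left hxε (norm_nonneg (x - y))
  have h6 := mul_le_mul_of_nonneg_left hyε (norm_nonneg (x - y))
  constructor <;> nlinarith [h3.1, h3.2, h4.1, h4.2]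

lemma eventually_norm_sub_le (h : IsSmoothBody K ν U) {x₀ : E n} (hx₀ : x₀ ∈ frontier K) {ε : ℝ}
    (hε : 0 < ε) : ∀ᶠ p in 𝓝 (x₀, x₀),
      ‖ν p.1 - ν p.2 - fderiv ℝ ν x₀ (p.1 - p.2)‖ ≤ ε * ‖p.1 - p.2‖ :=
  (h.hasStrictFDerivAt hx₀).isLittleO.def hε

lemma exists_local (h : IsSmoothBody K ν U) {x₀ : E n} (hx₀ : x₀ ∈ frontier K) {ε : ℝ}
    (hε : 0 < ε) : ∃ r > 0, ∀ x ∈ frontier K ∩ ball x₀ r, ∀ y ∈ frontier K ∩ ball x₀ r,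
      ‖ν x - ν x₀‖ ≤ ε ∧ |⟪ν x₀, x - y⟫| ≤ ε * ‖x - y‖ ∧
      ‖ν x - ν y - fderiv ℝ ν x₀ (x - y)‖ ≤ ε * ‖x - y‖ := by
  have h1 : ∀ᶠ z in 𝓝 x₀, ‖ν z - ν x₀‖ ≤ ε := by
    filter_upwards [(h.hasStrictFDerivAt hx₀).continuousAt.eventually (closedBall_mem_nhds _ hε)]
      with z hz
    exact mem_closedBall_iff_norm.1 hz
  obtain ⟨r₁, hr₁, h1⟩ := eventually_nhds_iff_ball.1 h1
  obtain ⟨r₂, hr₂, h2⟩ := exists_ball_of_eventually_prod (h.eventually_norm_sub_le hx₀ hε)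
  have h3 : ∀ z ∈ ball x₀ (min r₁ r₂), ‖ν z - ν x₀‖ ≤ ε := fun z hz =>
    h1 z (ball_subset_ball (min_le_left _ _) hz)
  have h4 : ball x₀ (min r₁ r₂) ⊆ ball x₀ r₂ := ball_subset_ball (min_le_right _ _)
  exact ⟨min r₁ r₂, lt_min hr₁ hr₂, fun x hx y hy => ⟨h3 x hx.2,
    h.abs_inner_sub_le hx.1 hy.1 (h3 x hx.2) (h3 y hy.2), h2 x (h4 hx.2) y (h4 hy.2)⟩⟩

end IsSmoothBody

lemma hausdorffMeasure_le_of_edist_le {X Y : Type*} [EMetricSpace X] [EMetricSpace Y]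
    [MeasurableSpace X] [BorelSpace X] [MeasurableSpace Y] [BorelSpace Y] {f : X → Y} {s : Set X}
    {C : NNReal} {d : ℝ} (hd : 0 ≤ d) (h : ∀ x ∈ s, ∀ y ∈ s, edist x y ≤ C * edist (f x) (f y)) :
    μH[d] s ≤ (C : ℝ≥0∞) ^ d * μH[d] (f '' s) := by
  rcases s.eq_empty_or_nonempty with rfl | hs
  · simp
  have : Nonempty X := ⟨hs.some⟩
  have hinj : Set.InjOn f s := by
    intro x hx y hy hxy
    have := h x hx y hy
    simpa [hxy] using this
  have hL : LipschitzOnWith C (Function.invFunOn f s) (f '' s) := by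
    rintro _ ⟨x, hx, rfl⟩ _ ⟨y, hy, rfl⟩
    rw [hinj.leftInvOn_invFunOn hx, hinj.leftInvOn_invFunOn hy]
    exact h x hx y hy
  have := hL.hausdorffMeasure_image_le hd
  rwa [hinj.leftInvOn_invFunOn.image_image] at this

/-- Linearised normal coordinates: orthogonal projection to the hyperplane `u^⊥`, with height. -/
def flat {n : ℕ} (u : E n) (p : E n × ℝ) : E n := tproj u p.1 + p.2 • u

lemma continuous_flat {n : ℕ} (u : E n) : Continuous (flat u) := by
  unfold flat; fun_prop

lemma flat_sub {n : ℕ} (u : E n) (p q : E n × ℝ) : flat u p - flat u q = flat u (p - q) := by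
  simp only [flat, Prod.fst_sub, Prod.snd_sub, map_sub, sub_smul]; abel

lemma inner_flat {n : ℕ} {u : E n} (hu : ‖u‖ = 1) (p : E n × ℝ) : ⟪u, flat u p⟫ = p.2 := by
  simp [flat, inner_add_right, inner_tproj hu, inner_smul_right, hu]

lemma norm_le_of_abs_inner_le {n : ℕ} {u : E n} (hu : ‖u‖ = 1) {x : E n} {ε : ℝ} (hε : ε < 1)
    (h : |⟪u, x⟫| ≤ ε * ‖x‖) : ‖x‖ ≤ (1 - ε)⁻¹ * ‖tproj u x‖ := by
  rw [inv_mul_eq_div, le_div_iff₀ (by linarith)]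
  have h1 : ‖x‖ ≤ ‖tproj u x‖ + |⟪u, x⟫| := by
    calc ‖x‖ = ‖tproj u x + ⟪u, x⟫ • u‖ := by simp [tproj_apply]
      _ ≤ _ := (norm_add_le _ _).trans (by simp [norm_smul, hu])
  nlinarith

lemma norm_tproj_le_flat {n : ℕ} {u : E n} (hu : ‖u‖ = 1) (p : E n × ℝ) :
    ‖tproj u p.1‖ ≤ ‖flat u p‖ := by
  refine abs_le_of_sq_le_sq' ?_ (norm_nonneg _) |>.2
  rw [flat, norm_tproj_add_sq hu]; nlinarith [sq_nonneg p.2]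

lemma abs_le_norm_flat {n : ℕ} {u : E n} (hu : ‖u‖ = 1) (p : E n × ℝ) :
    |p.2| ≤ ‖flat u p‖ := by
  refine abs_le_of_sq_le_sq ?_ (norm_nonneg _)
  rw [flat, norm_tproj_add_sq hu]; nlinarith [sq_nonneg ‖tproj u p.1‖]

/-- The slicing property of a normalising constant for the codimension one Hausdorff measure. -/
def IsSlicing (n : ℕ) (c : ℝ≥0∞) : Prop :=
  c ≠ 0 ∧ c ≠ ∞ ∧ ∀ u : E n, ‖u‖ = 1 → ∀ Y : Set (E n), MeasurableSet Y →
      volume Y = c * ∫⁻ s : ℝ, μH[(n : ℝ) - 1] (Y ∩ {y | ⟪u, y⟫ = s})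

/-- The normalised surface measure of `K`. -/
def surf {n : ℕ} (c : ℝ≥0∞) (K : Set (E n)) : Measure (E n) :=
  c • μH[(n : ℝ) - 1].restrict (frontier K)

lemma slice_flat {n : ℕ} {u : E n} (hu : ‖u‖ = 1) (Q : Set (E n × ℝ)) (s : ℝ) :
    (flat u '' Q) ∩ {y | ⟪u, y⟫ = s} = (fun x => flat u (x, s)) '' ((fun x => (x, s)) ⁻¹' Q) := by
  ext y
  constructor
  · rintro ⟨⟨⟨x, r⟩, hp, rfl⟩, hs⟩
    have : r = s := by simpa [inner_flat hu] using hs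
    subst this
    exact ⟨x, hp, rfl⟩
  · rintro ⟨x, hx, rfl⟩
    exact ⟨⟨(x, s), hx, rfl⟩, by simp [inner_flat hu]⟩

lemma hausdorffMeasure_flat_image_le {n : ℕ} (hn : 1 ≤ n) {u : E n} (hu : ‖u‖ = 1) (A : Set (E n))
    (s : ℝ) : μH[(n : ℝ) - 1] ((fun x => flat u (x, s)) '' A) ≤ μH[(n : ℝ) - 1] A := by
  have hn' : (0 : ℝ) ≤ (n : ℝ) - 1 := by
    have : (1 : ℝ) ≤ n := by exact_mod_cast hn
    linarith
  have : LipschitzOnWith 1 (fun x => flat u (x, s)) A := by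
    refine LipschitzOnWith.of_dist_le_mul fun x _ y _ => ?_
    rw [dist_eq_norm, dist_eq_norm, flat_sub]
    simpa [flat] using norm_tproj_le hu (x - y)
  simpa using this.hausdorffMeasure_image_le hn'

lemma hausdorffMeasure_le_flat_image {n : ℕ} (hn : 1 ≤ n) {u : E n} {A : Set (E n)}
    (s : ℝ) {C : NNReal} (hC : ∀ x ∈ A, ∀ y ∈ A, ‖x - y‖ ≤ C * ‖tproj u (x - y)‖) :
    μH[(n : ℝ) - 1] A ≤
      (C : ℝ≥0∞) ^ ((n : ℝ) - 1) * μH[(n : ℝ) - 1] ((fun x => flat u (x, s)) '' A) := by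
  have hn' : (0 : ℝ) ≤ (n : ℝ) - 1 := by
    have : (1 : ℝ) ≤ n := by exact_mod_cast hn
    linarith
  refine hausdorffMeasure_le_of_edist_le hn' fun x hx y hy => ?_
  have h1 : dist x y ≤ C * dist (flat u (x, s)) (flat u (y, s)) := by
    rw [dist_eq_norm, dist_eq_norm, flat_sub]
    simpa [flat] using hC x hx y hy
  rw [edist_dist, edist_dist, ← ENNReal.ofReal_coe_nnreal, ← ENNReal.ofReal_mul C.coe_nonneg]
  exact ENNReal.ofReal_le_ofReal h1

namespace IsSmoothBody

variable {n : ℕ} {K : Set (E n)} {ν : E n → E n} {U : Set (E n)}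

lemma exists_bilipschitz (h : IsSmoothBody K ν U) {x₀ : E n} (hx₀ : x₀ ∈ frontier K) {C : NNReal}
    (hC : 1 < C) : ∃ r > 0, ∀ x ∈ frontier K ∩ ball x₀ r, ∀ y ∈ frontier K ∩ ball x₀ r,
      ‖x - y‖ ≤ C * ‖tproj (ν x₀) (x - y)‖ := by
  have hC' : (1 : ℝ) < C := by exact_mod_cast hC
  obtain ⟨r, hr, H⟩ := h.exists_local hx₀ (ε := 1 - (C : ℝ)⁻¹) (by
    have := inv_lt_one_of_one_lt₀ hC'; linarith)
  refine ⟨r, hr, fun x hx y hy => ?_⟩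
  have := norm_le_of_abs_inner_le (h.unit x₀ hx₀) (by
    have : 0 < (C : ℝ)⁻¹ := by positivity
    linarith) (H x hx y hy).2.1
  simpa using this

lemma hausdorffMeasure_frontier_lt_top (h : IsSmoothBody K ν U) (hn : 1 ≤ n) {c : ℝ≥0∞}
    (hc : IsSlicing n c) : μH[(n : ℝ) - 1] (frontier K) < ∞ := by
  refine h.isCompact_frontier.measure_lt_top_of_nhdsWithin fun x₀ hx₀ => ?_
  obtain ⟨r, hr, H⟩ := h.exists_bilipschitz hx₀ (C := 2) (by norm_num)
  refine ⟨frontier K ∩ ball x₀ r, inter_mem_nhdsWithin _ (ball_mem_nhds _ hr), ?_⟩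
  have hu := h.unit x₀ hx₀
  obtain ⟨R, hR⟩ : ∃ R, frontier K ⊆ closedBall 0 R :=
    h.isCompact_frontier.isBounded.subset_closedBall 0
  have hvol : volume (closedBall (0 : E n) (R + 1)) < ∞ := measure_closedBall_lt_top
  rw [hc.2.2 _ hu _ measurableSet_closedBall] at hvol
  have hfin : ∫⁻ s : ℝ,
      μH[(n : ℝ) - 1] (closedBall (0 : E n) (R + 1) ∩ {y | ⟪ν x₀, y⟫ = s}) < ∞ := by
    refine lt_top_iff_ne_top.2 fun h0 => ?_
    rw [h0, ENNReal.mul_top hc.1] at hvol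
    exact lt_irrefl _ hvol
  obtain ⟨s, hs, hsf⟩ : ∃ s ∈ Set.Icc (0 : ℝ) 1,
      μH[(n : ℝ) - 1] (closedBall (0 : E n) (R + 1) ∩ {y | ⟪ν x₀, y⟫ = s}) < ∞ := by
    by_contra! hcon
    refine hfin.not_ge ?_
    calc (∞ : ℝ≥0∞) = ∫⁻ s in Set.Icc (0 : ℝ) 1, ∞ := by simp
      _ ≤ ∫⁻ s in Set.Icc (0 : ℝ) 1,
          μH[(n : ℝ) - 1] (closedBall (0 : E n) (R + 1) ∩ {y | ⟪ν x₀, y⟫ = s}) :=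
        setLIntegral_mono' measurableSet_Icc hcon
      _ ≤ _ := setLIntegral_le_lintegral _ _
  refine (hausdorffMeasure_le_flat_image hn s H).trans_lt ?_
  refine ENNReal.mul_lt_top (ENNReal.rpow_lt_top_of_nonneg (by
    have : (1 : ℝ) ≤ n := by exact_mod_cast hn
    linarith) ENNReal.coe_ne_top) (lt_of_le_of_lt (measure_mono ?_) hsf)
  rintro _ ⟨x, hx, rfl⟩
  refine ⟨?_, by simp [inner_flat hu]⟩
  have hxR : ‖x‖ ≤ R := by simpa using hR hx.1
  rw [mem_closedBall_zero_iff]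
  calc ‖flat (ν x₀) (x, s)‖ ≤ ‖tproj (ν x₀) x‖ + ‖s • ν x₀‖ := norm_add_le _ _
    _ ≤ R + 1 := by
      refine add_le_add ((norm_tproj_le hu x).trans hxR) ?_
      rw [norm_smul, hu, mul_one, Real.norm_eq_abs, abs_of_nonneg hs.1]; exact hs.2

lemma isFiniteMeasure_surf (h : IsSmoothBody K ν U) (hn : 1 ≤ n) {c : ℝ≥0∞}
    (hc : IsSlicing n c) : IsFiniteMeasure (surf c K) := by
  refine ⟨?_⟩
  rw [surf, Measure.smul_apply, Measure.restrict_apply_univ, smul_eq_mul]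
  exact ENNReal.mul_lt_top (lt_top_iff_ne_top.2 hc.2.1) (h.hausdorffMeasure_frontier_lt_top hn hc)

lemma volume_flat_image {c : ℝ≥0∞} (hc : IsSlicing n c) {u : E n} (hu : ‖u‖ = 1)
    {Q : Set (E n × ℝ)} (hQ : MeasurableSet Q) (hinj : Set.InjOn (flat u) Q) :
    volume (flat u '' Q) = c * ∫⁻ s : ℝ,
      μH[(n : ℝ) - 1] ((fun x => flat u (x, s)) '' ((fun x => (x, s)) ⁻¹' Q)) := by
  rw [hc.2.2 u hu _ (hQ.image_of_continuousOn_injOn (continuous_flat u).continuousOn hinj)]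
  simp_rw [slice_flat hu]

lemma prod_surf_apply {c : ℝ≥0∞} [IsFiniteMeasure (surf c K)] (hc : c ≠ ∞)
    {Q : Set (E n × ℝ)} (hQ : MeasurableSet Q) (hQK : Q ⊆ frontier K ×ˢ Set.univ) :
    ((surf c K).prod volume) Q
      = c * ∫⁻ s : ℝ, μH[(n : ℝ) - 1] ((fun x => (x, s)) ⁻¹' Q) := by
  rw [Measure.prod_apply_symm hQ, ← lintegral_const_mul' _ _ hc]
  refine lintegral_congr fun s => ?_
  have h1 : MeasurableSet ((fun x : E n => (x, s)) ⁻¹' Q) := hQ.preimage (by fun_prop)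
  have h2 : (fun x : E n => (x, s)) ⁻¹' Q ⊆ frontier K := fun x hx => (hQK hx).1
  rw [surf, Measure.smul_apply, Measure.restrict_apply h1, smul_eq_mul, Set.inter_eq_left.2 h2]

lemma volume_flat_image_le {c : ℝ≥0∞} [IsFiniteMeasure (surf c K)] (hn : 1 ≤ n)
    (hc : IsSlicing n c) {u : E n} (hu : ‖u‖ = 1) {Q : Set (E n × ℝ)}
    (hQ : MeasurableSet Q) (hQK : Q ⊆ frontier K ×ˢ Set.univ) (hinj : Set.InjOn (flat u) Q) :
    volume (flat u '' Q) ≤ ((surf c K).prod volume) Q := by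
  rw [volume_flat_image hc hu hQ hinj, prod_surf_apply hc.2.1 hQ hQK]
  refine mul_le_mul le_rfl ?_ bot_le bot_le
  exact lintegral_mono fun s => hausdorffMeasure_flat_image_le hn hu _ s

lemma le_volume_flat_image {c : ℝ≥0∞} [IsFiniteMeasure (surf c K)] (hn : 1 ≤ n)
    (hc : IsSlicing n c) {u : E n} (hu : ‖u‖ = 1) {Q : Set (E n × ℝ)}
    (hQ : MeasurableSet Q) (hQK : Q ⊆ frontier K ×ˢ Set.univ) (hinj : Set.InjOn (flat u) Q)
    {C : NNReal} (hC : ∀ p ∈ Q, ∀ q ∈ Q, ‖p.1 - q.1‖ ≤ C * ‖tproj u (p.1 - q.1)‖) :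
    ((surf c K).prod volume) Q ≤ (C : ℝ≥0∞) ^ ((n : ℝ) - 1) * volume (flat u '' Q) := by
  rw [volume_flat_image hc hu hQ hinj, prod_surf_apply hc.2.1 hQ hQK, mul_left_comm]
  gcongr
  rw [← lintegral_const_mul' _ _ (by
    have : (1 : ℝ) ≤ n := by exact_mod_cast hn
    exact ENNReal.rpow_ne_top_of_nonneg (by linarith) ENNReal.coe_ne_top)]
  exact lintegral_mono fun s => hausdorffMeasure_le_flat_image hn s
    fun x hx y hy => hC (x, s) hx (y, s) hy

lemma injOn_flat {u : E n} (hu : ‖u‖ = 1) {Q : Set (E n × ℝ)} {C : ℝ}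
    (hC : ∀ p ∈ Q, ∀ q ∈ Q, ‖p.1 - q.1‖ ≤ C * ‖tproj u (p.1 - q.1)‖) :
    Set.InjOn (flat u) Q := by
  intro p hp q hq hpq
  have h1 : p.2 = q.2 := by rw [← inner_flat hu p, hpq, inner_flat hu]
  have h2 : tproj u (p.1 - q.1) = 0 := by
    rw [map_sub, sub_eq_zero]
    simpa [flat, h1] using hpq
  have h3 := hC p hp q hq
  rw [h2, norm_zero, mul_zero, norm_le_zero_iff, sub_eq_zero] at h3
  exact Prod.ext h3 h1


lemma exists_tube_approx (h : IsSmoothBody K ν U) {x₀ : E n} (hx₀ : x₀ ∈ frontier K) {s₀ : ℝ}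
    (hs₀ : 0 ≤ s₀) {δ : ℝ} (hδ : 0 < δ) : ∃ r > 0, ∀ p ∈ (frontier K ∩ ball x₀ r) ×ˢ ball s₀ r,
      ∀ q ∈ (frontier K ∩ ball x₀ r) ×ˢ ball s₀ r,
      ‖tube ν p - tube ν q - (ContinuousLinearMap.id ℝ (E n) + s₀ • shape ν x₀)
        (flat (ν x₀) p - flat (ν x₀) q)‖ ≤ δ * ‖flat (ν x₀) p - flat (ν x₀) q‖ := by
  set u := ν x₀ with hu_def
  have hu : ‖u‖ = 1 := h.unit x₀ hx₀
  set D := fderiv ℝ ν x₀ with hD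
  set M : ℝ := 2 * (2 + s₀ + s₀ * ‖D‖ + ‖D‖) + 1 with hM
  have hM0 : 0 < M := by positivity
  set η : ℝ := min (1 / 2) (δ / M) with hη
  have hη0 : 0 < η := by positivity
  have hη1 : η ≤ 1 / 2 := min_le_left _ _
  have hη2 : η * M ≤ δ := by
    rw [← le_div_iff₀ hM0]; exact min_le_right _ _
  obtain ⟨r, hr, H⟩ := h.exists_local hx₀ hη0
  refine ⟨min r η, lt_min hr hη0, ?_⟩
  rintro ⟨x, s⟩ ⟨⟨hx, hxr⟩, hs⟩ ⟨y, t⟩ ⟨⟨hy, hyr⟩, -⟩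
  simp only at hx hxr hy hyr hs
  have hxr' := ball_subset_ball (min_le_left _ _) hxr
  have hyr' := ball_subset_ball (min_le_left _ _) hyr
  obtain ⟨-, h1, h2⟩ := H x ⟨hx, hxr'⟩ y ⟨hy, hyr'⟩
  obtain ⟨h3, -, -⟩ := H y ⟨hy, hyr'⟩ x ⟨hx, hxr'⟩
  have hs' : |s - s₀| ≤ η := by
    rw [← Real.dist_eq]; exact (hs.trans_le (min_le_right _ _)).le
  rw [flat_sub]
  set W := flat u ((x, s) - (y, t)) with hW
  set a := ⟪u, x - y⟫ with ha
  have hWs : |s - t| ≤ ‖W‖ := abs_le_norm_flat hu ((x, s) - (y, t))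
  have hWx : ‖x - y‖ ≤ 2 * ‖W‖ := by
    have h4 := norm_le_of_abs_inner_le hu (by linarith : η < 1) h1
    have h5 : ‖tproj u (x - y)‖ ≤ ‖W‖ := norm_tproj_le_flat hu ((x, s) - (y, t))
    have h6 : (1 - η)⁻¹ ≤ 2 := by
      rw [inv_le_comm₀ (by linarith) (by norm_num)]; linarith
    calc ‖x - y‖ ≤ (1 - η)⁻¹ * ‖tproj u (x - y)‖ := h4
      _ ≤ 2 * ‖W‖ := by gcongr
  have hLW : (ContinuousLinearMap.id ℝ (E n) + s₀ • shape ν x₀) W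
      = (x - y) - a • u + (s - t) • u + s₀ • (D (x - y) - a • D u) := by
    have h7 : tproj u W = x - y - a • u := by
      rw [hW, flat, map_add, map_smul, tproj_self hu, tproj_tproj hu, tproj_apply]; simp [ha]
    have h8 : W = x - y - a • u + (s - t) • u := by
      rw [hW, flat, tproj_apply]; simp [ha]
    have h9 : shape ν x₀ W = D (x - y) - a • D u := by
      simp only [shape, ContinuousLinearMap.comp_apply]
      rw [h7, map_sub, map_smul]
    simp only [_root_.add_apply, _root_.smul_apply,
      ContinuousLinearMap.id_apply, h9]
    rw [← h8]
  have hdiff : tube ν (x, s) - tube ν (y, t)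
      - (ContinuousLinearMap.id ℝ (E n) + s₀ • shape ν x₀) W
      = a • u + s₀ • (ν x - ν y - D (x - y)) + (s₀ * a) • D u + (s - s₀) • (ν x - ν y)
        + (s - t) • (ν y - u) := by
    rw [hLW]; simp only [tube]; module
  have h10 : ‖ν x - ν y‖ ≤ (‖D‖ + η) * ‖x - y‖ := by
    calc ‖ν x - ν y‖ = ‖(ν x - ν y - D (x - y)) + D (x - y)‖ := by congr 1; abel
      _ ≤ η * ‖x - y‖ + ‖D‖ * ‖x - y‖ := (norm_add_le _ _).trans
        (add_le_add h2 (D.le_opNorm _))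
      _ = _ := by ring
  have hDu : ‖D u‖ ≤ ‖D‖ := by simpa [hu] using D.le_opNorm u
  have hD0 := norm_nonneg D
  rw [hdiff]
  calc _ ≤ ‖a • u‖ + ‖s₀ • (ν x - ν y - D (x - y))‖ + ‖(s₀ * a) • D u‖
        + ‖(s - s₀) • (ν x - ν y)‖ + ‖(s - t) • (ν y - u)‖ := by
        refine (norm_add_le _ _).trans (add_le_add_left ?_ _)
        refine (norm_add_le _ _).trans (add_le_add_left ?_ _)
        refine (norm_add_le _ _).trans (add_le_add_left ?_ _)
        exact norm_add_le _ _
    _ ≤ η * ‖x - y‖ + s₀ * (η * ‖x - y‖) + s₀ * (η * ‖x - y‖) * ‖D‖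
        + η * ((‖D‖ + 1) * ‖x - y‖) + ‖W‖ * η := by
        simp only [norm_smul, Real.norm_eq_abs, abs_mul, abs_of_nonneg hs₀, hu, mul_one]
        gcongr
        exact h10.trans (by gcongr; linarith)
    _ = η * (2 + s₀ + s₀ * ‖D‖ + ‖D‖) * ‖x - y‖ + ‖W‖ * η := by ring
    _ ≤ η * (2 + s₀ + s₀ * ‖D‖ + ‖D‖) * (2 * ‖W‖) + ‖W‖ * η := by gcongr
    _ = η * M * ‖W‖ := by rw [hM]; ring
    _ ≤ δ * ‖W‖ := by gcongr

lemma exists_local_volume (h : IsSmoothBody K ν U) (hn : 1 ≤ n) {c : ℝ≥0∞}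
    [IsFiniteMeasure (surf c K)] (hc : IsSlicing n c) {x₀ : E n} (hx₀ : x₀ ∈ frontier K) {s₀ : ℝ}
    (hs₀ : 0 ≤ s₀) {C : NNReal} (hC : 1 < C) {m : NNReal} :
    ∃ r > 0, ∀ Q : Set (E n × ℝ), MeasurableSet Q → Q ⊆ (frontier K ∩ ball x₀ r) ×ˢ ball s₀ r →
      (ENNReal.ofReal (jac ν (x₀, s₀)) < m →
        volume (tube ν '' Q) ≤ m * ((surf c K).prod volume) Q) ∧
      ((m : ℝ≥0∞) < ENNReal.ofReal (jac ν (x₀, s₀)) →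
        m * ((surf c K).prod volume) Q ≤
          (C : ℝ≥0∞) ^ ((n : ℝ) - 1) * volume (tube ν '' Q)) := by
  set L := ContinuousLinearMap.id ℝ (E n) + s₀ • shape ν x₀ with hL
  have hu : ‖ν x₀‖ = 1 := h.unit x₀ hx₀
  obtain ⟨δ, hδ, h1, h2⟩ : ∃ δ : NNReal, 0 < δ ∧ (ENNReal.ofReal |L.det| < m →
      ∀ (s : Set (E n)) (f : E n → E n), ApproximatesLinearOn f L s δ →
        volume (f '' s) ≤ m * volume s) ∧ ((m : ℝ≥0∞) < ENNReal.ofReal |L.det| →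
      ∀ (s : Set (E n)) (f : E n → E n), ApproximatesLinearOn f L s δ →
        m * volume s ≤ volume (f '' s)) := by
    have e1 : ∀ᶠ δ in 𝓝[>] (0 : NNReal), (ENNReal.ofReal |L.det| < m →
      ∀ (s : Set (E n)) (f : E n → E n), ApproximatesLinearOn f L s δ →
        volume (f '' s) ≤ m * volume s) := by
      by_cases hm : ENNReal.ofReal |L.det| < m
      · filter_upwards [addHaar_image_le_mul_of_det_lt volume L hm] with δ hδ _ using hδ
      · exact Eventually.of_forall fun δ hm' => absurd hm' hm
    have e2 : ∀ᶠ δ in 𝓝[>] (0 : NNReal), ((m : ℝ≥0∞) < ENNReal.ofReal |L.det| →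
      ∀ (s : Set (E n)) (f : E n → E n), ApproximatesLinearOn f L s δ →
        m * volume s ≤ volume (f '' s)) := by
      by_cases hm : (m : ℝ≥0∞) < ENNReal.ofReal |L.det|
      · filter_upwards [mul_le_addHaar_image_of_lt_det volume L hm] with δ hδ _ using hδ
      · exact Eventually.of_forall fun δ hm' => absurd hm' hm
    obtain ⟨δ, ⟨h1, h2⟩, h3⟩ := ((e1.and e2).and self_mem_nhdsWithin).exists
    exact ⟨δ, h3, h1, h2⟩
  obtain ⟨r₁, hr₁, H1⟩ := h.exists_tube_approx hx₀ hs₀ (NNReal.coe_pos.2 hδ)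
  obtain ⟨r₂, hr₂, H2⟩ := h.exists_bilipschitz hx₀ hC
  refine ⟨min r₁ r₂, lt_min hr₁ hr₂, fun Q hQ hQr => ?_⟩
  have hQK : Q ⊆ frontier K ×ˢ Set.univ := fun p hp => ⟨(hQr hp).1.1, trivial⟩
  have hQ1 : ∀ p ∈ Q, p ∈ (frontier K ∩ ball x₀ r₁) ×ˢ ball s₀ r₁ := fun p hp =>
    ⟨⟨(hQr hp).1.1, ball_subset_ball (min_le_left _ _) (hQr hp).1.2⟩,
      ball_subset_ball (min_le_left _ _) (hQr hp).2⟩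
  have hQ2 : ∀ p ∈ Q, ∀ q ∈ Q, ‖p.1 - q.1‖ ≤ C * ‖tproj (ν x₀) (p.1 - q.1)‖ :=
    fun p hp q hq => H2 _ ⟨(hQr hp).1.1, ball_subset_ball (min_le_right _ _) (hQr hp).1.2⟩ _
      ⟨(hQr hq).1.1, ball_subset_ball (min_le_right _ _) (hQr hq).1.2⟩
  have hinj := injOn_flat hu hQ2
  set f : E n → E n := fun w => tube ν (Function.invFunOn (flat (ν x₀)) Q w) with hf
  have hfim : f '' (flat (ν x₀) '' Q) = tube ν '' Q := by
    rw [hf, ← Set.image_image (tube ν), hinj.leftInvOn_invFunOn.image_image]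
  have happ : ApproximatesLinearOn f L (flat (ν x₀) '' Q) δ := by
    rintro _ ⟨p, hp, rfl⟩ _ ⟨q, hq, rfl⟩
    simp only [hf, hinj.leftInvOn_invFunOn hp, hinj.leftInvOn_invFunOn hq]
    exact H1 p (hQ1 p hp) q (hQ1 q hq)
  have hj : jac ν (x₀, s₀) = |L.det| := rfl
  rw [hj]
  constructor
  · intro hm
    have := h1 hm _ f happ
    rw [hfim] at this
    exact this.trans (mul_le_mul le_rfl (volume_flat_image_le hn hc hu hQ hQK hinj) bot_le bot_le)
  · intro hm
    have := h2 hm _ f happ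
    rw [hfim] at this
    calc m * ((surf c K).prod volume) Q
        ≤ m * ((C : ℝ≥0∞) ^ ((n : ℝ) - 1) * volume (flat (ν x₀) '' Q)) :=
          mul_le_mul le_rfl (le_volume_flat_image hn hc hu hQ hQK hinj hQ2) bot_le bot_le
      _ = (C : ℝ≥0∞) ^ ((n : ℝ) - 1) * (m * volume (flat (ν x₀) '' Q)) := by ring
      _ ≤ _ := mul_le_mul le_rfl this bot_le bot_le

end IsSmoothBody

lemma exists_one_lt_rpow_le (n : ℕ) (hn : 1 ≤ n) {ε : NNReal} (hε : 0 < ε) :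
    ∃ C : NNReal, 1 < C ∧ (C : ℝ≥0∞) ^ ((n : ℝ) - 1) ≤ 1 + ε := by
  have hn0 : (0 : ℝ) < n := by exact_mod_cast hn
  have h1 : (1 : NNReal) < 1 + ε := by simpa using hε
  have hC : 1 < (1 + ε) ^ (n : ℝ)⁻¹ := NNReal.one_lt_rpow h1 (by positivity)
  refine ⟨(1 + ε) ^ (n : ℝ)⁻¹, hC, ?_⟩
  calc (((1 + ε) ^ (n : ℝ)⁻¹ : NNReal) : ℝ≥0∞) ^ ((n : ℝ) - 1)
      ≤ (((1 + ε) ^ (n : ℝ)⁻¹ : NNReal) : ℝ≥0∞) ^ (n : ℝ) :=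
        ENNReal.rpow_le_rpow_of_exponent_le (by exact_mod_cast hC.le) (by linarith)
    _ = 1 + ε := by
      rw [← ENNReal.coe_rpow_of_nonneg _ hn0.le, ← NNReal.rpow_mul, inv_mul_cancel₀ hn0.ne',
        NNReal.rpow_one]
      simp

namespace IsSmoothBody

variable {n : ℕ} {K : Set (E n)} {ν : E n → E n} {U : Set (E n)}

lemma exists_local_integral (h : IsSmoothBody K ν U) (hn : 1 ≤ n) {c : ℝ≥0∞}
    [IsFiniteMeasure (surf c K)] (hc : IsSlicing n c) {p₀ : E n × ℝ}
    (hp₀ : p₀ ∈ frontier K ×ˢ Set.Ici (0 : ℝ)) {ε : NNReal} (hε : 0 < ε) :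
    ∃ r > 0, ∀ Q : Set (E n × ℝ), MeasurableSet Q → Q ⊆ frontier K ×ˢ Set.univ → Q ⊆ ball p₀ r →
      volume (tube ν '' Q) ≤ (∫⁻ p in Q, ENNReal.ofReal (jac ν p) ∂(surf c K).prod volume)
        + 2 * ε * ((surf c K).prod volume) Q ∧
      (∫⁻ p in Q, ENNReal.ofReal (jac ν p) ∂(surf c K).prod volume)
        ≤ (1 + ε) * volume (tube ν '' Q) + 2 * ε * ((surf c K).prod volume) Q := by
  obtain ⟨x₀, s₀⟩ := p₀
  obtain ⟨hx₀, hs₀⟩ := hp₀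
  obtain ⟨C, hC, hCn⟩ := exists_one_lt_rpow_le n hn hε
  set j := (jac ν (x₀, s₀)).toNNReal with hj
  have hjac : ∀ p, 0 ≤ jac ν p := fun p => abs_nonneg _
  have hj' : ENNReal.ofReal (jac ν (x₀, s₀)) = j := rfl
  obtain ⟨r₁, hr₁, H1⟩ := h.exists_local_volume hn hc hx₀ hs₀ hC (m := j + ε)
  obtain ⟨r₂, hr₂, H2⟩ := h.exists_local_volume hn hc hx₀ hs₀ hC (m := j - ε)
  obtain ⟨r₃, hr₃, H3⟩ := Metric.continuousWithinAt_iff.1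
    (h.continuousOn_jac (x₀, s₀) ⟨hx₀, trivial⟩) ε (by exact_mod_cast hε)
  refine ⟨min r₁ (min r₂ r₃), by positivity, fun Q hQ hQK hQr => ?_⟩
  have hb : ∀ p ∈ Q, p.1 ∈ ball x₀ (min r₁ (min r₂ r₃)) ∧ p.2 ∈ ball s₀ (min r₁ (min r₂ r₃)) := by
    intro p hp
    have : p ∈ ball x₀ (min r₁ (min r₂ r₃)) ×ˢ ball s₀ (min r₁ (min r₂ r₃)) := by
      rw [ball_prod_same]; exact hQr hp
    exact this
  have hQ1 : Q ⊆ (frontier K ∩ ball x₀ r₁) ×ˢ ball s₀ r₁ := fun p hp =>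
    ⟨⟨(hQK hp).1, ball_subset_ball (min_le_left _ _) (hb p hp).1⟩,
      ball_subset_ball (min_le_left _ _) (hb p hp).2⟩
  have hle2 : min r₁ (min r₂ r₃) ≤ r₂ := (min_le_right _ _).trans (min_le_left _ _)
  have hle3 : min r₁ (min r₂ r₃) ≤ r₃ := (min_le_right _ _).trans (min_le_right _ _)
  have hQ2 : Q ⊆ (frontier K ∩ ball x₀ r₂) ×ˢ ball s₀ r₂ := fun p hp =>
    ⟨⟨(hQK hp).1, ball_subset_ball hle2 (hb p hp).1⟩, ball_subset_ball hle2 (hb p hp).2⟩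
  have hJ : ∀ p ∈ Q, (jac ν p).toNNReal ≤ j + ε ∧ j ≤ (jac ν p).toNNReal + ε := by
    intro p hp
    have h4 := H3 (hQK hp) ((hQr hp).trans_le hle3)
    rw [Real.dist_eq, abs_lt] at h4
    rw [← NNReal.coe_le_coe, ← NNReal.coe_le_coe, NNReal.coe_add, NNReal.coe_add, hj,
      Real.coe_toNNReal _ (hjac _), Real.coe_toNNReal _ (hjac _)]
    constructor <;> linarith [h4.1, h4.2]
  constructor
  · have h5 := (H1 Q hQ hQ1).1 (by
      rw [hj']; exact_mod_cast lt_add_of_pos_right j hε)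
    refine h5.trans ?_
    calc ((j + ε : NNReal) : ℝ≥0∞) * ((surf c K).prod volume) Q
        = ∫⁻ p in Q, ((j + ε : NNReal) : ℝ≥0∞) ∂(surf c K).prod volume := by
          rw [setLIntegral_const]
      _ ≤ ∫⁻ p in Q, (ENNReal.ofReal (jac ν p) + 2 * ε) ∂(surf c K).prod volume := by
          refine setLIntegral_mono' hQ fun p hp => ?_
          have := (hJ p hp).2
          have h6 : j + ε ≤ (jac ν p).toNNReal + 2 * ε := by
            calc j + ε ≤ (jac ν p).toNNReal + ε + ε := by gcongr
              _ = _ := by ring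
          rw [ENNReal.ofReal]
          exact_mod_cast h6
      _ = _ := by rw [lintegral_add_right _ measurable_const, setLIntegral_const]
  · rcases le_or_gt j ε with hjε | hjε
    · calc _ ≤ ∫⁻ p in Q, (2 * ε : ℝ≥0∞) ∂(surf c K).prod volume := by
            refine setLIntegral_mono' hQ fun p hp => ?_
            have h6 : (jac ν p).toNNReal ≤ 2 * ε := (hJ p hp).1.trans (by rw [two_mul]; gcongr)
            rw [ENNReal.ofReal]
            exact_mod_cast h6
        _ = 2 * ε * ((surf c K).prod volume) Q := by rw [setLIntegral_const]
        _ ≤ _ := le_add_self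
    · have h5 := (H2 Q hQ hQ2).2 (by
        rw [hj']
        exact_mod_cast tsub_lt_self (hε.trans hjε) hε)
      calc _ ≤ ∫⁻ p in Q, (((j - ε : NNReal) : ℝ≥0∞) + 2 * ε) ∂(surf c K).prod volume := by
            refine setLIntegral_mono' hQ fun p hp => ?_
            have h6 : (jac ν p).toNNReal ≤ (j - ε) + 2 * ε := (hJ p hp).1.trans (by
              rw [two_mul, ← add_assoc, tsub_add_cancel_of_le hjε.le])
            rw [ENNReal.ofReal]
            exact_mod_cast h6
        _ = (j - ε : NNReal) * ((surf c K).prod volume) Q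
            + 2 * ε * ((surf c K).prod volume) Q := by
            rw [lintegral_add_right _ measurable_const, setLIntegral_const, setLIntegral_const]
        _ ≤ _ := add_le_add (h5.trans (mul_le_mul hCn le_rfl bot_le bot_le)) le_rfl

lemma volume_tube_image_approx (h : IsSmoothBody K ν U) (hn : 1 ≤ n) {c : ℝ≥0∞}
    [IsFiniteMeasure (surf c K)] (hc : IsSlicing n c) {Q : Set (E n × ℝ)} (hQ : MeasurableSet Q)
    (hQK : Q ⊆ frontier K ×ˢ Set.Ici (0 : ℝ)) {ε : NNReal} (hε : 0 < ε) :
      volume (tube ν '' Q) ≤ (∫⁻ p in Q, ENNReal.ofReal (jac ν p) ∂(surf c K).prod volume)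
        + 2 * ε * ((surf c K).prod volume) Q ∧
      (∫⁻ p in Q, ENNReal.ofReal (jac ν p) ∂(surf c K).prod volume)
        ≤ (1 + ε) * volume (tube ν '' Q) + 2 * ε * ((surf c K).prod volume) Q := by
  rcases Q.eq_empty_or_nonempty with rfl | hne
  · simp
  choose! r hr H using fun p hp => h.exists_local_integral hn hc (p₀ := p) hp hε
  obtain ⟨t, hts, htc, hcov⟩ := TopologicalSpace.countable_cover_nhdsWithin
    (f := fun p => ball p (r p)) (s := frontier K ×ˢ Set.Ici (0 : ℝ))
    fun p hp => mem_nhdsWithin_of_mem_nhds (ball_mem_nhds _ (hr p hp))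
  have htne : t.Nonempty := by
    obtain ⟨p, hp⟩ := hne
    obtain ⟨q, hq, -⟩ := Set.mem_iUnion₂.1 (hcov (hQK hp))
    exact ⟨q, hq⟩
  obtain ⟨f, rfl⟩ := htc.exists_eq_range htne
  have hfs : ∀ i, f i ∈ frontier K ×ˢ Set.Ici (0 : ℝ) := fun i => hts ⟨i, rfl⟩
  set V : ℕ → Set (E n × ℝ) := fun i => ball (f i) (r (f i)) with hV
  set A : ℕ → Set (E n × ℝ) := fun i => Q ∩ disjointed V i with hA
  have hAm : ∀ i, MeasurableSet (A i) := fun i =>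
    hQ.inter (MeasurableSet.disjointed (fun i => measurableSet_ball) i)
  have hAQ : ⋃ i, A i = Q := by
    rw [← Set.inter_iUnion, iUnion_disjointed, Set.inter_eq_left]
    intro p hp
    obtain ⟨_, ⟨i, rfl⟩, hi⟩ := Set.mem_iUnion₂.1 (hcov (hQK hp))
    exact Set.mem_iUnion.2 ⟨i, hi⟩
  have hAd : Pairwise (Function.onFun Disjoint A) := fun i j hij =>
    (disjoint_disjointed V hij).mono Set.inter_subset_right Set.inter_subset_right
  have hAK : ∀ i, A i ⊆ frontier K ×ˢ Set.Ici (0 : ℝ) := fun i p hp => hQK hp.1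
  have hAu : ∀ i, A i ⊆ frontier K ×ˢ Set.univ := fun i p hp => ⟨(hQK hp.1).1, trivial⟩
  have hAloc := fun i => H (f i) (hfs i) (A i) (hAm i) (hAu i)
    fun p hp => disjointed_subset V i hp.2
  have hvol : volume (tube ν '' Q) = ∑' i, volume (tube ν '' A i) := by
    rw [← hAQ, Set.image_iUnion, measure_iUnion]
    · intro i j hij
      refine Set.disjoint_left.2 ?_
      rintro _ ⟨p, hp, rfl⟩ ⟨q, hq, hqp⟩
      obtain rfl := h.injOn_tube (hAK j hq) (hAK i hp) hqp
      exact Set.disjoint_left.1 (hAd hij) hp hq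
    · exact fun i => (hAm i).image_of_continuousOn_injOn (h.continuousOn_tube.mono (hAu i))
        (h.injOn_tube.mono (hAK i))
  have hintg : (∫⁻ p in Q, ENNReal.ofReal (jac ν p) ∂(surf c K).prod volume)
      = ∑' i, ∫⁻ p in A i, ENNReal.ofReal (jac ν p) ∂(surf c K).prod volume := by
    rw [← hAQ, lintegral_iUnion hAm hAd]
  have hρ : ((surf c K).prod volume) Q = ∑' i, ((surf c K).prod volume) (A i) := by
    rw [← hAQ, measure_iUnion hAd hAm]
  rw [hvol, hintg, hρ, ← ENNReal.tsum_mul_left, ← ENNReal.tsum_mul_left, ← ENNReal.tsum_add,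
    ← ENNReal.tsum_add]
  exact ⟨ENNReal.tsum_le_tsum fun i => (hAloc i).1, ENNReal.tsum_le_tsum fun i => (hAloc i).2⟩

/-- The volume of a set given in normal coordinates. -/
lemma volume_tube_image (h : IsSmoothBody K ν U) (hn : 1 ≤ n) {c : ℝ≥0∞}
    [IsFiniteMeasure (surf c K)] (hc : IsSlicing n c) {Q : Set (E n × ℝ)} (hQ : MeasurableSet Q)
    (hQK : Q ⊆ frontier K ×ˢ Set.Ici (0 : ℝ)) (hQf : ((surf c K).prod volume) Q ≠ ∞) :
    volume (tube ν '' Q) = ∫⁻ p in Q, ENNReal.ofReal (jac ν p) ∂(surf c K).prod volume := by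
  have key := fun ε : NNReal => fun hε : 0 < ε => h.volume_tube_image_approx hn hc hQ hQK hε
  have h0 : Tendsto (fun ε : NNReal => (ε : ℝ≥0∞)) (𝓝[>] 0) (𝓝 0) := by
    have : Tendsto (fun ε : NNReal => (ε : ℝ≥0∞)) (𝓝 0) (𝓝 ((0 : NNReal) : ℝ≥0∞)) :=
      ENNReal.continuous_coe.tendsto 0
    exact this.mono_left nhdsWithin_le_nhds
  have h1 : Tendsto (fun ε : NNReal => 2 * (ε : ℝ≥0∞) * ((surf c K).prod volume) Q)
      (𝓝[>] 0) (𝓝 0) := by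
    have := ENNReal.Tendsto.mul_const (ENNReal.Tendsto.const_mul (a := 2) h0 (Or.inr (by simp)))
      (b := ((surf c K).prod volume) Q) (Or.inr hQf)
    simpa using this
  apply le_antisymm
  · have h2 : Tendsto (fun ε : NNReal =>
        (∫⁻ p in Q, ENNReal.ofReal (jac ν p) ∂(surf c K).prod volume)
          + 2 * ε * ((surf c K).prod volume) Q) (𝓝[>] 0)
        (𝓝 ((∫⁻ p in Q, ENNReal.ofReal (jac ν p) ∂(surf c K).prod volume) + 0)) :=
      tendsto_const_nhds.add h1
    rw [add_zero] at h2
    exact ge_of_tendsto h2 (eventually_mem_nhdsWithin.mono fun ε hε => (key ε hε).1)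
  · have h2 : Tendsto (fun ε : NNReal => (1 + (ε : ℝ≥0∞)) * volume (tube ν '' Q)
          + 2 * ε * ((surf c K).prod volume) Q) (𝓝[>] 0)
        (𝓝 ((1 + 0) * volume (tube ν '' Q) + 0)) := by
      refine Tendsto.add ?_ h1
      exact ENNReal.Tendsto.mul_const (tendsto_const_nhds.add h0) (Or.inl (by simp))
    rw [add_zero, add_zero, one_mul] at h2
    exact ge_of_tendsto h2 (eventually_mem_nhdsWithin.mono fun ε hε => (key ε hε).2)

end IsSmoothBody

lemma det_eq_det_matrix {n : ℕ} (A : E n →L[ℝ] E n) :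
    A.det = Matrix.det (LinearMap.toMatrix (EuclideanSpace.basisFun (Fin n) ℝ).toBasis
      (EuclideanSpace.basisFun (Fin n) ℝ).toBasis (A : E n →ₗ[ℝ] E n)) :=
  (LinearMap.det_toMatrix _ _).symm

lemma differentiable_det {n : ℕ} : Differentiable ℝ fun A : E n →L[ℝ] E n => A.det := by
  simp_rw [det_eq_det_matrix, Matrix.det_apply, LinearMap.toMatrix_apply]
  refine Differentiable.fun_sum fun σ _ => Differentiable.const_smul (fun A => ?_) _
  simp only [OrthonormalBasis.coe_toBasis_repr_apply, OrthonormalBasis.repr_apply_apply,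
    ContinuousLinearMap.coe_coe]
  have h1 : ∀ i ∈ Finset.univ, DifferentiableAt ℝ (fun A : E n →L[ℝ] E n =>
      ⟪EuclideanSpace.basisFun (Fin n) ℝ (σ i),
        A ((EuclideanSpace.basisFun (Fin n) ℝ).toBasis i)⟫) A :=
    fun i _ => DifferentiableAt.inner ℝ (differentiableAt_const _) (by fun_prop)
  exact (HasFDerivAt.finsetProd fun i hi => (h1 i hi).hasFDerivAt).differentiableAt

lemma hasDerivAt_det_one_add_smul {n : ℕ} (A : E n →L[ℝ] E n) :
    HasDerivAt (fun s : ℝ => (ContinuousLinearMap.id ℝ (E n) + s • A).det)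
      (LinearMap.trace ℝ (E n) A) 0 := by
  set b := (EuclideanSpace.basisFun (Fin n) ℝ).toBasis
  set M := LinearMap.toMatrix b b (A : E n →ₗ[ℝ] E n) with hM
  have h1 : ∀ s : ℝ, (ContinuousLinearMap.id ℝ (E n) + s • A).det = (1 + s • M).det := by
    intro s
    rw [det_eq_det_matrix]
    congr 1
    rw [hM, ← map_smul, ← LinearMap.toMatrix_id b, ← map_add]
    rfl
  have h3 : (fun s : ℝ => (ContinuousLinearMap.id ℝ (E n) + s • A).det) = fun s : ℝ =>
      1 + M.trace * s + (Matrix.det (1 + (Polynomial.X : Polynomial ℝ) •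
        M.map Polynomial.C)).divX.divX.eval s * s ^ 2 :=
    funext fun s => (h1 s).trans (Matrix.det_one_add_smul s M)
  rw [h3]
  rw [LinearMap.trace_eq_matrix_trace ℝ b]
  have h2 := ((hasDerivAt_const (0 : ℝ) (1 : ℝ)).add
    ((hasDerivAt_id (0 : ℝ)).const_mul M.trace)).add
    (((Matrix.det (1 + (Polynomial.X : Polynomial ℝ) • M.map Polynomial.C)).divX.divX.hasDerivAt
      0).mul ((hasDerivAt_id (0 : ℝ)).pow 2))
  refine h2.congr_deriv ?_
  simp [hM]

lemma fderiv_det_one {n : ℕ} (A : E n →L[ℝ] E n) :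
    fderiv ℝ (fun A : E n →L[ℝ] E n => A.det) (ContinuousLinearMap.id ℝ (E n)) A
      = LinearMap.trace ℝ (E n) A := by
  have h1 : HasDerivAt (fun s : ℝ => ContinuousLinearMap.id ℝ (E n) + s • A) A 0 := by
    simpa using ((hasDerivAt_id (0 : ℝ)).smul_const A).const_add (ContinuousLinearMap.id ℝ (E n))
  have h2 : HasFDerivAt (fun A : E n →L[ℝ] E n => A.det)
      (fderiv ℝ (fun A : E n →L[ℝ] E n => A.det) (ContinuousLinearMap.id ℝ (E n)))
      (ContinuousLinearMap.id ℝ (E n) + (0 : ℝ) • A) := by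
    have h3 : ContinuousLinearMap.id ℝ (E n) + (0 : ℝ) • A = ContinuousLinearMap.id ℝ (E n) := by
      ext; simp
    rw [h3]
    exact (differentiable_det _).hasFDerivAt
  have h4 := h2.comp_hasDerivAt (0 : ℝ) h1
  exact h4.unique (hasDerivAt_det_one_add_smul A)

lemma exists_det_expansion {n : ℕ} {η : ℝ} (hη : 0 < η) : ∃ r > 0, ∀ A : E n →L[ℝ] E n, ‖A‖ < r →
    abs (abs (ContinuousLinearMap.id ℝ (E n) + A).det - 1 - LinearMap.trace ℝ (E n) A)
      ≤ η * ‖A‖ := by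
  have h1 := (differentiable_det (n := n) (ContinuousLinearMap.id ℝ (E n))).hasFDerivAt
  have h2 := h1.isLittleO.def hη
  have h3 : ∀ᶠ A in 𝓝 (ContinuousLinearMap.id ℝ (E n)), 0 < A.det :=
    ContinuousLinearMap.continuous_det.continuousAt.eventually
      (lt_mem_nhds (by simp [ContinuousLinearMap.det]))
  obtain ⟨r, hr, H⟩ := eventually_nhds_iff_ball.1 (h2.and h3)
  refine ⟨r, hr, fun A hA => ?_⟩
  obtain ⟨h4, h5⟩ := H (ContinuousLinearMap.id ℝ (E n) + A) (by simpa [dist_eq_norm] using hA)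
  rw [add_sub_cancel_left, fderiv_det_one, Real.norm_eq_abs] at h4
  rw [abs_of_pos h5]
  convert! h4 using 3
  simp [ContinuousLinearMap.det]

/-- The mean curvature: the trace of the Weingarten map. -/
def meanCurv {n : ℕ} (ν : E n → E n) (x : E n) : ℝ := LinearMap.trace ℝ (E n) (shape ν x)

lemma continuous_trace {n : ℕ} : Continuous fun A : E n →L[ℝ] E n =>
    LinearMap.trace ℝ (E n) (A : E n →ₗ[ℝ] E n) := by
  simp_rw [LinearMap.trace_eq_sum_inner _ (EuclideanSpace.basisFun (Fin n) ℝ)]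
  simp only [ContinuousLinearMap.coe_coe]
  fun_prop

lemma inner_tproj_comm {n : ℕ} (u x y : E n) : ⟪x, tproj u y⟫ = ⟪tproj u x, y⟫ := by
  simp only [tproj_apply, inner_sub_left, inner_sub_right, inner_smul_left, inner_smul_right,
    real_inner_comm x u, RCLike.conj_to_real]
  ring

namespace IsSmoothBody

variable {n : ℕ} {K : Set (E n)} {ν : E n → E n} {U : Set (E n)}

lemma continuousOn_meanCurv (h : IsSmoothBody K ν U) : ContinuousOn (meanCurv ν) (frontier K) :=
  continuous_trace.comp_continuousOn h.continuousOn_shape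

lemma exists_jac_expansion (h : IsSmoothBody K ν U) {η : ℝ} (hη : 0 < η) :
    ∃ r > 0, ∀ x ∈ frontier K, ∀ s : ℝ, 0 ≤ s → s < r →
      |jac ν (x, s) - 1 - s * meanCurv ν x| ≤ η * s := by
  obtain ⟨B, hB⟩ := h.isCompact_frontier.exists_bound_of_continuousOn h.continuousOn_shape
  set B' := max B 0 + 1 with hB'
  have hB0 : 0 < B' := by positivity
  have hBB : ∀ x ∈ frontier K, ‖shape ν x‖ ≤ B' := fun x hx =>
    (hB x hx).trans (by rw [hB']; linarith [le_max_left B 0])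
  obtain ⟨r, hr, H⟩ := exists_det_expansion (n := n) (η := η / B') (by positivity)
  refine ⟨r / B', by positivity, fun x hx s hs hsr => ?_⟩
  have h1 : ‖s • shape ν x‖ ≤ s * B' := by
    rw [norm_smul, Real.norm_eq_abs, abs_of_nonneg hs]
    exact mul_le_mul_of_nonneg_left (hBB x hx) hs
  have h2 := H (s • shape ν x) (h1.trans_lt ((lt_div_iff₀ hB0).1 hsr))
  have h3 : LinearMap.trace ℝ (E n) (s • shape ν x : E n →L[ℝ] E n) = s * meanCurv ν x := by
    rw [ContinuousLinearMap.toLinearMap_smul, map_smul, smul_eq_mul, meanCurv]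
  rw [h3] at h2
  refine h2.trans ?_
  calc η / B' * ‖s • shape ν x‖ ≤ η / B' * (s * B') := by gcongr
    _ = η * s := by field_simp

lemma le_meanCurv (h : IsSmoothBody K ν U) {α : ℝ} {x : E n} (hx : x ∈ frontier K)
    (hα : ∀ v ∈ (ℝ ∙ (ν x))ᗮ, α * ‖v‖ ^ 2 ≤ ⟪fderiv ℝ ν x v, v⟫) :
    ((n : ℝ) - 1) * α ≤ meanCurv ν x := by
  set b := EuclideanSpace.basisFun (Fin n) ℝ
  have hu := h.unit x hx
  set P := tproj (ν x) with hP
  set D := fderiv ℝ ν x with hD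
  have h1 : meanCurv ν x = LinearMap.trace ℝ (E n) (P.comp (D.comp P) : E n →L[ℝ] E n) := by
    have h2 : P.comp P = P := ContinuousLinearMap.ext fun y => tproj_tproj hu y
    calc meanCurv ν x = LinearMap.trace ℝ (E n) (D.comp P : E n →L[ℝ] E n) := rfl
      _ = LinearMap.trace ℝ (E n) ((D.comp P).comp P : E n →L[ℝ] E n) := by
        rw [ContinuousLinearMap.comp_assoc, h2]
      _ = _ := by
        rw [ContinuousLinearMap.toLinearMap_comp, ContinuousLinearMap.toLinearMap_comp P]
        exact LinearMap.trace_mul_comm ℝ _ _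
  have h3 : ∀ i, α * (1 - ⟪ν x, b i⟫ ^ 2) ≤ ⟪b i, P (D (P (b i)))⟫ := by
    intro i
    have h4 : P (b i) ∈ (ℝ ∙ (ν x))ᗮ := by
      rw [Submodule.mem_orthogonal_singleton_iff_inner_right]
      exact inner_tproj hu _
    have h5 := hα _ h4
    have h6 := norm_sq_eq_tproj hu (b i)
    have h7 : ‖b i‖ = 1 := b.norm_eq_one i
    rw [h7] at h6
    rw [hP, inner_tproj_comm, ← hP, real_inner_comm (D _)]
    have h8 : ‖P (b i)‖ ^ 2 = 1 - ⟪ν x, b i⟫ ^ 2 := by rw [hP]; linarith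
    rwa [h8] at h5
  have h9 : ∑ i, ⟪ν x, b i⟫ ^ 2 = 1 := by
    have := b.sum_sq_norm_inner_left (ν x)
    simpa [hu] using this
  rw [h1, LinearMap.trace_eq_sum_inner _ b]
  calc ((n : ℝ) - 1) * α = ∑ i, α * (1 - ⟪ν x, b i⟫ ^ 2) := by
        rw [← Finset.mul_sum, Finset.sum_sub_distrib, h9]; simp; ring
    _ ≤ _ := Finset.sum_le_sum fun i _ => h3 i

end IsSmoothBody

/-- Radial projection from an interior point onto the boundary of a convex set. -/
lemma exists_radial_projection {n : ℕ} {K : Set (E n)} (hK : Convex ℝ K) (hintg : (interior K).Nonempty)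
    {q : E n} (hq : q ∈ frontier K) : ∃ x : E n → E n, ContinuousAt x q ∧ x q = q ∧
      ∀ᶠ y in 𝓝 q, x y ∈ frontier K ∧
        (y ∉ K → ∃ a : ℝ, 0 ≤ a ∧ ∃ o ∈ K, y - x y = a • (x y - o)) := by
  obtain ⟨o, ho⟩ := hintg
  set K' : Set (E n) := (fun v => o + v) ⁻¹' K with hK'
  have hc : Convex ℝ K' := hK.translate_preimage_right o
  have h0 : K' ∈ 𝓝 (0 : E n) := by
    have : Tendsto (fun v : E n => o + v) (𝓝 0) (𝓝 o) := by
      have h1 : Continuous fun v : E n => o + v := by fun_prop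
      simpa using h1.tendsto 0
    exact this (mem_interior_iff_mem_nhds.1 ho)
  have hfr : ∀ v, o + v ∈ frontier K ↔ gauge K' v = 1 := by
    intro v
    rw [gauge_eq_one_iff_mem_frontier hc h0]
    have := (Homeomorph.addLeft o).preimage_frontier K
    exact (Set.ext_iff.1 this v)
  have hgc : Continuous fun y => gauge K' (y - o) :=
    (continuous_gauge hc h0).comp (continuous_id.sub continuous_const)
  have hgq : gauge K' (q - o) = 1 := by rw [← hfr]; simpa using hq
  refine ⟨fun y => o + (gauge K' (y - o))⁻¹ • (y - o), ?_, ?_, ?_⟩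
  · have h1 : ContinuousAt (fun y => (gauge K' (y - o))⁻¹) q :=
      hgc.continuousAt.inv₀ (by rw [hgq]; exact one_ne_zero)
    exact continuousAt_const.add (h1.smul (continuousAt_id.sub continuousAt_const))
  · simp [hgq]
  · have hpos : ∀ᶠ y in 𝓝 q, 0 < gauge K' (y - o) :=
      hgc.continuousAt.eventually (lt_mem_nhds (by simp [hgq]))
    filter_upwards [hpos] with y hy
    refine ⟨?_, fun hyK => ?_⟩
    · rw [hfr, gauge_smul_of_nonneg (inv_nonneg.2 hy.le), smul_eq_mul, inv_mul_cancel₀ hy.ne']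
    · refine ⟨gauge K' (y - o) - 1, ?_, o, interior_subset ho, ?_⟩
      · rw [sub_nonneg]
        refine one_le_gauge_of_notMem (hc.starConvex (mem_of_mem_nhds h0))
          (absorbent_nhds_zero h0 _) ?_
        simpa [hK'] using hyK
      · have h2 : (gauge K' (y - o) - 1) * (gauge K' (y - o))⁻¹ = 1 - (gauge K' (y - o))⁻¹ := by
          field_simp
        rw [add_sub_cancel_left, smul_smul, h2]
        module

namespace IsSmoothBody

variable {n : ℕ} {K : Set (E n)} {ν : E n → E n} {U : Set (E n)}

lemma normal_unique (h : IsSmoothBody K ν U) {q u : E n} (hq : q ∈ frontier K) (hu : ‖u‖ = 1)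
    (hout : ∀ y ∈ K, ⟪y - q, u⟫ ≤ 0) : u = ν q := by
  by_contra hne
  set w := u - ν q with hw
  have hw0 : 0 < ‖w‖ ^ 2 := by
    have : w ≠ 0 := sub_ne_zero.2 hne
    positivity
  have hν := h.unit q hq
  have hsq : ‖w‖ ^ 2 = 2 - 2 * ⟪u, ν q⟫ := by
    rw [hw, norm_sub_sq_real, hu, hν]; ring
  have hwu : ⟪w, u⟫ = ‖w‖ ^ 2 / 2 := by
    rw [hsq, hw, inner_sub_left, real_inner_self_eq_norm_sq, hu, real_inner_comm]; ring
  have hwν : ⟪w, ν q⟫ = -(‖w‖ ^ 2 / 2) := by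
    rw [hsq, hw, inner_sub_left, real_inner_self_eq_norm_sq, hν]; ring
  obtain ⟨x, hxc, hxq, hx⟩ := exists_radial_projection h.conv h.int hq
  have hpath : Tendsto (fun ε : ℝ => q + ε • w) (𝓝[>] 0) (𝓝 q) := by
    have h1 : Continuous fun ε : ℝ => q + ε • w := by fun_prop
    have h2 := h1.tendsto 0
    simp only [zero_smul, add_zero] at h2
    exact h2.mono_left nhdsWithin_le_nhds
  have hνc : ContinuousAt ν q := (h.hasStrictFDerivAt hq).continuousAt
  have hlim : Tendsto (fun ε : ℝ => ⟪w, ν (x (q + ε • w))⟫) (𝓝[>] 0) (𝓝 ⟪w, ν q⟫) := by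
    refine tendsto_const_nhds.inner ?_
    have h3 : Tendsto x (𝓝 q) (𝓝 q) := by
      have := hxc.tendsto
      rwa [hxq] at this
    exact hνc.tendsto.comp (h3.comp hpath)
  have hge : ∀ᶠ ε in 𝓝[>] (0 : ℝ), 0 ≤ ⟪w, ν (x (q + ε • w))⟫ := by
    filter_upwards [hpath.eventually hx, self_mem_nhdsWithin] with ε hε hε0
    have hε0 : 0 < ε := hε0
    obtain ⟨hfr, hrad⟩ := hε
    obtain ⟨a, ha, o, ho, hao⟩ := hrad fun hmem => by
      have := hout _ hmem
      rw [add_sub_cancel_left, inner_smul_left, hwu] at this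
      have h4 : 0 < ε * (‖w‖ ^ 2 / 2) := by positivity
      exact absurd this (not_le.2 h4)
    set z := x (q + ε • w) with hz
    have h5 := h.outer z hfr q (h.frontier_subset hq)
    have h6 := h.inner_sub_nonneg hfr ho
    have h7 : ⟪q + ε • w - z, ν z⟫ = a * ⟪z - o, ν z⟫ := by
      rw [hao, inner_smul_left]; rfl
    have h8 : ⟪q + ε • w - z, ν z⟫ = ⟪q - z, ν z⟫ + ε * ⟪w, ν z⟫ := by
      have : q + ε • w - z = (q - z) + ε • w := by abel
      rw [this, inner_add_left, inner_smul_left]; rfl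
    have h9 : 0 ≤ ε * ⟪w, ν z⟫ := by nlinarith [mul_nonneg ha h6]
    exact nonneg_of_mul_nonneg_right h9 hε0
  have := ge_of_tendsto hlim hge
  rw [hwν] at this
  linarith

/-- Every point outside of the body has normal coordinates, the height being the distance. -/
lemma exists_tube_eq (h : IsSmoothBody K ν U) {z : E n} (hz : z ∉ K) :
    ∃ q ∈ frontier K, 0 < infDist z K ∧ tube ν (q, infDist z K) = z := by
  have hne : K.Nonempty := h.int.mono interior_subset
  obtain ⟨q, hq, hdist⟩ := h.comp.exists_infDist_eq_dist hne z
  have hpos : 0 < infDist z K := (h.comp.isClosed.notMem_iff_infDist_pos hne).1 hz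
  have hn : ‖z - q‖ = infDist z K := by rw [hdist, dist_eq_norm]
  have hproj : ∀ w ∈ K, ⟪z - q, w - q⟫ ≤ 0 := by
    rw [← norm_eq_iInf_iff_real_inner_le_zero h.conv hq, hn, infDist_eq_iInf]
    simp_rw [dist_eq_norm]
  have hqf : q ∈ frontier K := by
    refine ⟨subset_closure hq, fun hqi => ?_⟩
    have h1 : Tendsto (fun t : ℝ => q + t • (z - q)) (𝓝[>] 0) (𝓝 q) := by
      have h1 : Continuous fun t : ℝ => q + t • (z - q) := by fun_prop
      have h2 := h1.tendsto 0
      simp only [zero_smul, add_zero] at h2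
      exact h2.mono_left nhdsWithin_le_nhds
    obtain ⟨t, ht, ht0⟩ := ((h1.eventually (mem_interior_iff_mem_nhds.1 hqi)).and
      self_mem_nhdsWithin).exists
    have ht0 : 0 < t := ht0
    have h3 := hproj _ ht
    rw [add_sub_cancel_left, inner_smul_right, real_inner_self_eq_norm_sq, hn] at h3
    have h4 : 0 < t * infDist z K ^ 2 := by positivity
    linarith
  refine ⟨q, hqf, hpos, ?_⟩
  have hν : (infDist z K)⁻¹ • (z - q) = ν q := by
    refine h.normal_unique hqf ?_ fun y hy => ?_
    · rw [norm_smul, hn, Real.norm_eq_abs, abs_of_pos (inv_pos.2 hpos), inv_mul_cancel₀ hpos.ne']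
    · rw [inner_smul_right, real_inner_comm]
      exact mul_nonpos_of_nonneg_of_nonpos (inv_nonneg.2 hpos.le) (hproj y hy)
  rw [tube, ← hν, smul_smul, mul_inv_cancel₀ hpos.ne', one_smul, add_sub_cancel]


lemma exists_local_monotone (h : IsSmoothBody K ν U) {x₀ : E n} (hx₀ : x₀ ∈ frontier K) {α α' B : ℝ}
    (hα0 : 0 < α) (hα : ∀ v ∈ (ℝ ∙ (ν x₀))ᗮ, α * ‖v‖ ^ 2 ≤ ⟪fderiv ℝ ν x₀ v, v⟫) (hαα : α' < α)
    (hB : ‖fderiv ℝ ν x₀‖ ≤ B) :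
    ∃ r > 0, ∀ x ∈ frontier K ∩ ball x₀ r, ∀ y ∈ frontier K ∩ ball x₀ r,
      α' * ‖x - y‖ ^ 2 ≤ ⟪ν x - ν y, x - y⟫ ∧ ‖ν x - ν y‖ ≤ (B + 1) * ‖x - y‖ := by
  have hu := h.unit x₀ hx₀
  set u := ν x₀ with hu_def
  set D := fderiv ℝ ν x₀ with hD
  have hB0 : 0 ≤ B := (norm_nonneg _).trans hB
  set η := min 1 ((α - α') / (α + 2 * B + 1)) with hη
  have hη0 : 0 < η := lt_min one_pos (div_pos (sub_pos.2 hαα) (by positivity))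
  have hη1 : η ≤ 1 := min_le_left _ _
  have hη2 : η * (α + 2 * B + 1) ≤ α - α' := by
    rw [← le_div_iff₀ (by positivity)]; exact min_le_right _ _
  obtain ⟨r, hr, H⟩ := h.exists_local hx₀ hη0
  refine ⟨r, hr, fun x hx y hy => ?_⟩
  obtain ⟨-, h1, h2⟩ := H x hx y hy
  set v := x - y with hv
  set a := ⟪u, v⟫ with ha
  set T := tproj u v with hT
  have hvT : v = T + a • u := by rw [hT, tproj_apply]; simp [ha]
  have hTv : ‖T‖ ≤ ‖v‖ := norm_tproj_le hu v
  have hDle : ∀ w, ‖D w‖ ≤ B * ‖w‖ := fun w => (D.le_opNorm w).trans (by gcongr)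
  constructor
  · have h3 : α * ‖T‖ ^ 2 ≤ ⟪D T, T⟫ := hα T (by
      rw [Submodule.mem_orthogonal_singleton_iff_inner_right]; exact inner_tproj hu _)
    have h4 : ⟪D v, v⟫ = ⟪D T, T⟫ + a * ⟪D T, u⟫ + a * ⟪D u, v⟫ := by
      conv_lhs => rw [hvT]
      rw [map_add, inner_add_left, inner_add_right, map_smul, ← hvT]
      simp [inner_smul_left, inner_smul_right]
    have h5 : |⟪D T, u⟫| ≤ B * ‖v‖ := by
      refine (abs_real_inner_le_norm _ _).trans ?_
      rw [hu, mul_one]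
      exact (hDle T).trans (by gcongr)
    have h6 : |⟪D u, v⟫| ≤ B * ‖v‖ := by
      refine (abs_real_inner_le_norm _ _).trans ?_
      have := hDle u
      rw [hu, mul_one] at this
      gcongr
    have h7 : |a * ⟪D T, u⟫| ≤ η * ‖v‖ * (B * ‖v‖) := by rw [abs_mul]; gcongr
    have h8 : |a * ⟪D u, v⟫| ≤ η * ‖v‖ * (B * ‖v‖) := by rw [abs_mul]; gcongr
    have h9 : |⟪ν x - ν y - D v, v⟫| ≤ η * ‖v‖ * ‖v‖ :=
      (abs_real_inner_le_norm _ _).trans (by gcongr)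
    have h10 : ⟪ν x - ν y, v⟫ = ⟪ν x - ν y - D v, v⟫ + ⟪D v, v⟫ := by
      rw [← inner_add_left, sub_add_cancel]
    have h11 := norm_sq_eq_tproj hu v
    have h12 : a ^ 2 ≤ η * ‖v‖ ^ 2 := by
      have : a ^ 2 ≤ (η * ‖v‖) ^ 2 := sq_le_sq' (by linarith [(abs_le.1 h1).1]) (abs_le.1 h1).2
      have h13 : η ^ 2 ≤ η := by nlinarith
      calc a ^ 2 ≤ (η * ‖v‖) ^ 2 := this
        _ = η ^ 2 * ‖v‖ ^ 2 := by ring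
        _ ≤ η * ‖v‖ ^ 2 := by gcongr
    rw [h10, h4]
    have h14 : η * (α + 2 * B + 1) * ‖v‖ ^ 2 ≤ (α - α') * ‖v‖ ^ 2 := by gcongr
    have h15 : α * ‖T‖ ^ 2 = α * ‖v‖ ^ 2 - α * a ^ 2 := by
      have : ‖T‖ ^ 2 = ‖v‖ ^ 2 - a ^ 2 := by rw [h11]; ring
      rw [this]; ring
    have h16 : α * a ^ 2 ≤ α * (η * ‖v‖ ^ 2) := by gcongr
    linarith [(abs_le.1 h7).1, (abs_le.1 h8).1, (abs_le.1 h9).1]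
  · calc ‖ν x - ν y‖ = ‖(ν x - ν y - D v) + D v‖ := by rw [sub_add_cancel]
      _ ≤ η * ‖v‖ + B * ‖v‖ := (norm_add_le _ _).trans (add_le_add h2 (hDle v))
      _ ≤ (B + 1) * ‖v‖ := by nlinarith [norm_nonneg v]

lemma exists_uniform_of_local (h : IsSmoothBody K ν U) {P : E n → E n → Prop}
    (hP : ∀ x₀ ∈ frontier K, ∃ r > 0, ∀ x ∈ frontier K ∩ ball x₀ r, ∀ y ∈ frontier K ∩ ball x₀ r,
      P x y) : ∃ δ > 0, ∀ x ∈ frontier K, ∀ y ∈ frontier K, ‖x - y‖ < δ → P x y := by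
  choose! r hr H using hP
  obtain ⟨δ, hδ, hcov⟩ := lebesgue_number_lemma_of_metric h.isCompact_frontier
    (c := fun x : frontier K => ball (x : E n) (r x)) (fun _ => isOpen_ball)
    fun x hx => Set.mem_iUnion.2 ⟨⟨x, hx⟩, mem_ball_self (hr x hx)⟩
  refine ⟨δ, hδ, fun x hx y hy hxy => ?_⟩
  obtain ⟨i, hi⟩ := hcov x hx
  refine H i i.2 x ⟨hx, hi (mem_ball_self hδ)⟩ y ⟨hy, hi ?_⟩
  rw [mem_ball, dist_comm, dist_eq_norm]; exact hxy

lemma exists_monotone (h : IsSmoothBody K ν U) {α α' : ℝ} (hα0 : 0 < α)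
    (hα : ∀ x ∈ frontier K, ∀ v ∈ (ℝ ∙ (ν x))ᗮ, α * ‖v‖ ^ 2 ≤ ⟪fderiv ℝ ν x v, v⟫)
    (hαα : α' < α) : ∃ L > 0, ∃ δ > 0, ∀ x ∈ frontier K, ∀ y ∈ frontier K, ‖x - y‖ < δ →
      α' * ‖x - y‖ ^ 2 ≤ ⟪ν x - ν y, x - y⟫ ∧ ‖ν x - ν y‖ ≤ L * ‖x - y‖ := by
  obtain ⟨B, hB⟩ := h.isCompact_frontier.exists_bound_of_continuousOn h.continuousOn_fderiv
  refine ⟨max B 0 + 1, by positivity, h.exists_uniform_of_local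
    (P := fun x y => α' * ‖x - y‖ ^ 2 ≤ ⟪ν x - ν y, x - y⟫ ∧
      ‖ν x - ν y‖ ≤ (max B 0 + 1) * ‖x - y‖) fun x₀ hx₀ => ?_⟩
  exact h.exists_local_monotone hx₀ hα0 (hα x₀ hx₀) hαα ((hB x₀ hx₀).trans (le_max_left _ _))

lemma exists_push (h : IsSmoothBody K ν U) {q b : E n} (hq : q ∈ frontier K) (hb : b ∈ K) :
    ∃ s : ℝ, 0 ≤ s ∧ s ≤ ⟪q - b, ν q⟫ ∧ b + s • ν q ∈ frontier K := by
  have hν := h.unit q hq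
  have hle : ∀ s : ℝ, b + s • ν q ∈ K → s ≤ ⟪q - b, ν q⟫ := by
    intro s hs
    have h1 := h.inner_sub_nonneg hq hs
    have h2 : q - (b + s • ν q) = (q - b) - s • ν q := by abel
    rw [h2, inner_sub_left, inner_smul_left, real_inner_self_eq_norm_sq, hν] at h1
    simp only [RCLike.conj_to_real] at h1
    linarith
  have hcont : Continuous fun s : ℝ => b + s • ν q := by fun_prop
  set A : Set ℝ := Set.Icc 0 ⟪q - b, ν q⟫ ∩ (fun s : ℝ => b + s • ν q) ⁻¹' K with hA
  have hAc : IsCompact A := isCompact_Icc.inter_right (h.comp.isClosed.preimage hcont)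
  have hA0 : (0 : ℝ) ∈ A := by
    have : b + (0 : ℝ) • ν q ∈ K := by simpa using hb
    exact ⟨⟨le_rfl, hle 0 this⟩, this⟩
  obtain ⟨s, hs, hmax⟩ := hAc.exists_isGreatest ⟨0, hA0⟩
  refine ⟨s, hs.1.1, hs.1.2, subset_closure hs.2, fun hintg => ?_⟩
  have h1 : ∀ᶠ t in 𝓝[>] s, b + t • ν q ∈ K :=
    (hcont.continuousAt.eventually (mem_interior_iff_mem_nhds.1 hintg)).filter_mono
      nhdsWithin_le_nhds
  obtain ⟨t, ht, hst⟩ := (h1.and self_mem_nhdsWithin).exists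
  have hst : s < t := hst
  exact absurd (hmax ⟨⟨hs.1.1.trans hst.le, hle t ht⟩, ht⟩) (not_le.2 hst)

set_option maxHeartbeats 800000 in
lemma exists_midpoint_estimate (h : IsSmoothBody K ν U) {α α' : ℝ} (hα0 : 0 < α)
    (hα : ∀ x ∈ frontier K, ∀ v ∈ (ℝ ∙ (ν x))ᗮ, α * ‖v‖ ^ 2 ≤ ⟪fderiv ℝ ν x v, v⟫)
    (hα'0 : 0 < α') (hαα : α' < α) :
    ∃ δ > 0, ∀ q ∈ frontier K, ∀ x ∈ frontier K, ‖x - q‖ < δ → ∃ m ∈ frontier K,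
      ‖m - q‖ < δ ∧ ‖x - m‖ < δ ∧ ‖x - q‖ ^ 2 / 2 ≤ ‖m - q‖ ^ 2 + ‖x - m‖ ^ 2 ∧
      ⟪q - m, ν q⟫ + ⟪m - x, ν m⟫ + α' / 4 * ‖x - q‖ ^ 2 ≤ ⟪q - x, ν q⟫ := by
  obtain ⟨β, hβ1, hβ2⟩ := exists_between hαα
  have hβ0 : 0 < β := hα'0.trans hβ1
  obtain ⟨L, hL, δ₀, hδ₀, H⟩ := h.exists_monotone hα0 hα hβ2
  set δ := min δ₀ (min (1 / L) ((β - α') / (4 * (β * L + L ^ 2)))) with hδ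
  have hδpos : 0 < δ := lt_min hδ₀ (lt_min (by positivity)
    (div_pos (sub_pos.2 hβ1) (by positivity)))
  refine ⟨δ, hδpos, fun q hq x hx hxq => ?_⟩
  set u := x - q with hu
  have hν := h.unit q hq
  have hδ1 : ‖u‖ < δ₀ := hxq.trans_le (min_le_left _ _)
  have hδ2 : ‖u‖ * L ≤ 1 := by
    rw [← le_div_iff₀ hL]
    exact hxq.le.trans ((min_le_right _ _).trans (min_le_left _ _))
  have hδ3 : ‖u‖ * (4 * (β * L + L ^ 2)) ≤ β - α' := by
    rw [← le_div_iff₀ (by positivity)]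
    exact hxq.le.trans ((min_le_right _ _).trans (min_le_right _ _))
  have hb : (2⁻¹ : ℝ) • q + (2⁻¹ : ℝ) • x ∈ K :=
    h.conv (h.frontier_subset hq) (h.frontier_subset hx) (by norm_num) (by norm_num) (by norm_num)
  obtain ⟨s, hs0, hs1, hm⟩ := h.exists_push hq hb
  set m := (2⁻¹ : ℝ) • q + (2⁻¹ : ℝ) • x + s • ν q with hm_def
  have hω0 : 0 ≤ ⟪q - x, ν q⟫ := h.inner_sub_nonneg hq (h.frontier_subset hx)
  have hω1 : ⟪q - x, ν q⟫ ≤ L * ‖u‖ ^ 2 := by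
    have h1 := h.inner_sub_nonneg hx (h.frontier_subset hq)
    have h2 : ⟪q - x, ν q⟫ ≤ ⟪u, ν x - ν q⟫ := by
      rw [hu, inner_sub_right, ← neg_sub x q, inner_neg_left]; linarith
    calc _ ≤ ⟪u, ν x - ν q⟫ := h2
      _ ≤ ‖u‖ * ‖ν x - ν q‖ := real_inner_le_norm _ _
      _ ≤ ‖u‖ * (L * ‖u‖) := by gcongr; exact (H x hx q hq hδ1).2
      _ = _ := by ring
  have hs2 : s ≤ L * ‖u‖ ^ 2 / 2 := by
    have h1 : q - ((2⁻¹ : ℝ) • q + (2⁻¹ : ℝ) • x) = (2⁻¹ : ℝ) • (q - x) := by module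
    rw [h1, inner_smul_left] at hs1
    simp only [RCLike.conj_to_real] at hs1
    linarith
  have hs3 : s ≤ ‖u‖ / 2 := by
    linarith [mul_le_mul_of_nonneg_right hδ2 (norm_nonneg u)]
  have hmq : m - q = (2⁻¹ : ℝ) • u + s • ν q := by rw [hm_def, hu]; module
  have hxm : x - m = (2⁻¹ : ℝ) • u - s • ν q := by rw [hm_def, hu]; module
  have hsν : ‖s • ν q‖ = s := by rw [norm_smul, hν, Real.norm_eq_abs, abs_of_nonneg hs0, mul_one]
  have hhalf : ‖(2⁻¹ : ℝ) • u‖ = ‖u‖ / 2 := by rw [norm_smul]; norm_num; ring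
  have hmq_le : ‖m - q‖ ≤ ‖u‖ := by
    rw [hmq]; refine (norm_add_le _ _).trans ?_; rw [hsν, hhalf]; linarith
  have hxm_le : ‖x - m‖ ≤ ‖u‖ := by
    rw [hxm]; refine (norm_sub_le _ _).trans ?_; rw [hsν, hhalf]; linarith
  have hmq_sq : ‖m - q‖ ^ 2 = ‖u‖ ^ 2 / 4 - s * ⟪q - x, ν q⟫ + s ^ 2 := by
    have h1 : ⟪q - x, ν q⟫ = -⟪u, ν q⟫ := by rw [← inner_neg_left, hu, neg_sub]
    rw [hmq, norm_add_sq_real, hsν, hhalf, inner_smul_left, inner_smul_right, h1]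
    simp only [RCLike.conj_to_real]; ring
  have hxm_sq : ‖x - m‖ ^ 2 = ‖u‖ ^ 2 / 4 + s * ⟪q - x, ν q⟫ + s ^ 2 := by
    have h1 : ⟪q - x, ν q⟫ = -⟪u, ν q⟫ := by rw [← inner_neg_left, hu, neg_sub]
    rw [hxm, norm_sub_sq_real, hsν, hhalf, inner_smul_left, inner_smul_right, h1]
    simp only [RCLike.conj_to_real]; ring
  refine ⟨m, hm, hmq_le.trans_lt hxq, hxm_le.trans_lt hxq, by
    rw [hmq_sq, hxm_sq]; linarith [sq_nonneg s], ?_⟩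
  obtain ⟨h1, h2⟩ := H m hm q hq (hmq_le.trans_lt hδ1)
  have h3 : ⟪q - x, ν q⟫ = ⟪q - m, ν q⟫ + ⟪m - x, ν m⟫ + ⟪x - m, ν m - ν q⟫ := by
    simp only [inner_sub_left, inner_sub_right]; ring
  have h4 : ⟪x - m, ν m - ν q⟫ = ⟪ν m - ν q, m - q⟫ - 2 * s * ⟪ν q, ν m - ν q⟫ := by
    have : x - m = (m - q) - (2 * s) • ν q := by rw [hxm, hmq]; module
    rw [this, inner_sub_left, inner_smul_left, real_inner_comm]; rfl
  have h5 : ⟪ν q, ν m - ν q⟫ ≤ L * ‖u‖ := by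
    calc ⟪ν q, ν m - ν q⟫ ≤ ‖ν q‖ * ‖ν m - ν q‖ := real_inner_le_norm _ _
      _ ≤ L * ‖m - q‖ := by rw [hν, one_mul]; exact h2
      _ ≤ L * ‖u‖ := by gcongr
  have h6 : 2 * s * ⟪ν q, ν m - ν q⟫ ≤ L ^ 2 * ‖u‖ * ‖u‖ ^ 2 := by
    calc 2 * s * ⟪ν q, ν m - ν q⟫ ≤ 2 * s * (L * ‖u‖) := by gcongr
      _ ≤ 2 * (L * ‖u‖ ^ 2 / 2) * (L * ‖u‖) := by gcongr
      _ = _ := by ring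
  have h7 : s * ⟪q - x, ν q⟫ ≤ L * ‖u‖ * ‖u‖ ^ 2 := by
    calc s * ⟪q - x, ν q⟫ ≤ ‖u‖ / 2 * (L * ‖u‖ ^ 2) := by gcongr
      _ ≤ _ := by linarith [mul_nonneg (mul_nonneg hL.le (norm_nonneg u)) (sq_nonneg ‖u‖)]
  have h8 : β * (‖u‖ ^ 2 / 4 - L * ‖u‖ * ‖u‖ ^ 2) ≤ β * ‖m - q‖ ^ 2 := by
    refine mul_le_mul_of_nonneg_left ?_ hβ0.le; rw [hmq_sq]; linarith [sq_nonneg s]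
  have h9 : ‖u‖ * (4 * (β * L + L ^ 2)) * ‖u‖ ^ 2 ≤ (β - α') * ‖u‖ ^ 2 := by gcongr
  rw [h3, h4]
  linarith

/-- Local quadratic lower bound for the height of tangent hyperplanes above the boundary. -/
lemma exists_quadratic (h : IsSmoothBody K ν U) {α α' : ℝ} (hα0 : 0 < α)
    (hα : ∀ x ∈ frontier K, ∀ v ∈ (ℝ ∙ (ν x))ᗮ, α * ‖v‖ ^ 2 ≤ ⟪fderiv ℝ ν x v, v⟫)
    (hα'0 : 0 < α') (hαα : α' < α) : ∃ δ > 0, ∀ q ∈ frontier K, ∀ x ∈ frontier K, ‖x - q‖ < δ →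
      α' / 2 * ‖x - q‖ ^ 2 ≤ ⟪q - x, ν q⟫ := by
  obtain ⟨δ, hδ, H⟩ := h.exists_midpoint_estimate hα0 hα hα'0 hαα
  refine ⟨δ, hδ, ?_⟩
  have key : ∀ k : ℕ, ∀ q ∈ frontier K, ∀ x ∈ frontier K, ‖x - q‖ < δ →
      α' / 2 * (1 - (2⁻¹ : ℝ) ^ k) * ‖x - q‖ ^ 2 ≤ ⟪q - x, ν q⟫ := by
    intro k
    induction k with
    | zero =>
      intro q hq x hx _
      simpa using h.inner_sub_nonneg hq (h.frontier_subset hx)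
    | succ k ih =>
      intro q hq x hx hxq
      obtain ⟨m, hm, h1, h2, h3, h4⟩ := H q hq x hx hxq
      have h5 := ih q hq m hm h1
      have h6 := ih m hm x hx h2
      have h7 : 0 ≤ α' / 2 * (1 - (2⁻¹ : ℝ) ^ k) := by
        have : (2⁻¹ : ℝ) ^ k ≤ 1 := pow_le_one₀ (by norm_num) (by norm_num)
        exact mul_nonneg (by positivity) (by linarith)
      have h8 := mul_le_mul_of_nonneg_left h3 h7
      rw [pow_succ]
      linarith
  intro q hq x hx hxq
  have hlim : Tendsto (fun k : ℕ => α' / 2 * (1 - (2⁻¹ : ℝ) ^ k) * ‖x - q‖ ^ 2) atTop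
      (𝓝 (α' / 2 * (1 - 0) * ‖x - q‖ ^ 2)) :=
    ((tendsto_const_nhds.sub (tendsto_pow_atTop_nhds_zero_of_lt_one (by norm_num)
      (by norm_num))).const_mul _).mul_const _
  rw [sub_zero, mul_one] at hlim
  exact le_of_tendsto' hlim fun k => key k q hq x hx hxq

lemma exists_norm_lt (h : IsSmoothBody K ν U) {α : ℝ} (hα0 : 0 < α)
    (hα : ∀ x ∈ frontier K, ∀ v ∈ (ℝ ∙ (ν x))ᗮ, α * ‖v‖ ^ 2 ≤ ⟪fderiv ℝ ν x v, v⟫) {δ : ℝ}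
    (hδ : 0 < δ) : ∃ κ > 0, ∀ q ∈ frontier K, ∀ x ∈ frontier K, ⟪q - x, ν q⟫ < κ →
      ‖x - q‖ < δ := by
  obtain ⟨δ₀, hδ₀, H⟩ := h.exists_quadratic hα0 hα (half_pos hα0) (half_lt_self hα0)
  set ρ := min δ δ₀ with hρ
  have hρ0 : 0 < ρ := lt_min hδ hδ₀
  refine ⟨min (ρ / 4) (α / 2 / 2 * (ρ / 4) ^ 2), by positivity, fun q hq x hx hω => ?_⟩
  by_contra! hge
  have hρle : ρ ≤ ‖x - q‖ := (min_le_left _ _).trans hge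
  have hpos : 0 < ‖x - q‖ := hρ0.trans_le hρle
  set τ := ρ / 2 / ‖x - q‖ with hτ
  have hτ0 : 0 < τ := by positivity
  have hτ1 : τ ≤ 1 := by rw [hτ, div_le_one hpos]; linarith
  have hb : (1 - τ) • q + τ • x ∈ K :=
    h.conv (h.frontier_subset hq) (h.frontier_subset hx) (by linarith) hτ0.le (by ring)
  obtain ⟨s, hs0, hs1, hm⟩ := h.exists_push hq hb
  set m := (1 - τ) • q + τ • x + s • ν q with hm_def
  have hν := h.unit q hq
  have hω0 : 0 ≤ ⟪q - x, ν q⟫ := h.inner_sub_nonneg hq (h.frontier_subset hx)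
  have h1 : ⟪q - ((1 - τ) • q + τ • x), ν q⟫ ≤ ⟪q - x, ν q⟫ := by
    have : q - ((1 - τ) • q + τ • x) = τ • (q - x) := by module
    rw [this, inner_smul_left]
    simp only [RCLike.conj_to_real]
    exact mul_le_of_le_one_left hω0 hτ1
  have h2 : ⟪q - m, ν q⟫ ≤ ⟪q - x, ν q⟫ := by
    have : q - m = (q - ((1 - τ) • q + τ • x)) - s • ν q := by rw [hm_def]; abel
    rw [this, inner_sub_left, inner_smul_left, real_inner_self_eq_norm_sq, hν]
    simp only [RCLike.conj_to_real]
    linarith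
  have hmq : m - q = τ • (x - q) + s • ν q := by rw [hm_def]; module
  have hsν : ‖s • ν q‖ = s := by rw [norm_smul, hν, Real.norm_eq_abs, abs_of_nonneg hs0, mul_one]
  have hτn : ‖τ • (x - q)‖ = ρ / 2 := by
    rw [norm_smul, Real.norm_eq_abs, abs_of_pos hτ0, hτ, div_mul_cancel₀ _ hpos.ne']
  have hs4 : s < ρ / 4 := (hs1.trans h1).trans_lt (hω.trans_le (min_le_left _ _))
  have h3 : ‖m - q‖ < δ₀ := by
    rw [hmq]
    refine (norm_add_le _ _).trans_lt ?_
    rw [hτn, hsν]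
    linarith [min_le_right δ δ₀]
  have h4 : ρ / 4 ≤ ‖m - q‖ := by
    have h5 : ‖τ • (x - q)‖ ≤ ‖m - q‖ + ‖s • ν q‖ := by
      have : τ • (x - q) = (m - q) - s • ν q := by rw [hmq]; abel
      rw [this]; exact norm_sub_le _ _
    rw [hτn, hsν] at h5
    linarith
  have h6 := H q hq m hm h3
  have h7 : α / 2 / 2 * (ρ / 4) ^ 2 ≤ α / 2 / 2 * ‖m - q‖ ^ 2 := by gcongr
  linarith [hω.trans_le (min_le_right _ _)]

end IsSmoothBody

/-- The body obtained from `K` by adding the normal segments of length `f` over the boundary. -/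
def bump {n : ℕ} (K : Set (E n)) (ν : E n → E n) (f : E n → ℝ) : Set (E n) :=
  K ∪ tube ν '' {p | p.1 ∈ frontier K ∧ 0 < p.2 ∧ p.2 ≤ f p.1}

lemma fderiv_eq_inner_gradient {n : ℕ} (ψ : E n → ℝ) (x v : E n) :
    fderiv ℝ ψ x v = ⟪gradient ψ x, v⟫ := by
  rw [gradient, InnerProductSpace.toDual_symm_apply]

lemma continuous_gradient {n : ℕ} {ψ : E n → ℝ} (hψ : ContDiff ℝ 1 ψ) :
    Continuous (gradient ψ) :=
  (InnerProductSpace.toDual ℝ (E n)).symm.continuous.comp (hψ.continuous_fderiv one_ne_zero)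

namespace IsSmoothBody

variable {n : ℕ} {K : Set (E n)} {ν : E n → E n} {U : Set (E n)}

lemma continuousOn_tgrad (h : IsSmoothBody K ν U) {ψ : E n → ℝ} (hψ : ContDiff ℝ 1 ψ) :
    ContinuousOn (fun x => tproj (ν x) (gradient ψ x)) (frontier K) := by
  simp only [tproj_apply]
  have hg := (continuous_gradient hψ).continuousOn (s := frontier K)
  have hi : ContinuousOn (fun x => ⟪ν x, gradient ψ x⟫) (frontier K) := h.continuousOn.inner hg
  exact hg.sub (hi.smul h.continuousOn)

lemma exists_gradient_expansion (h : IsSmoothBody K ν U) {ψ : E n → ℝ} (hψ : ContDiff ℝ 1 ψ)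
    {ε : ℝ} (hε : 0 < ε) : ∃ δ > 0, ∀ q ∈ frontier K, ∀ x ∈ frontier K, ‖q - x‖ < δ →
      |ψ x - ψ q - ⟪gradient ψ q, x - q⟫| ≤ ε * ‖x - q‖ := by
  refine h.exists_uniform_of_local
    (P := fun q x => |ψ x - ψ q - ⟪gradient ψ q, x - q⟫| ≤ ε * ‖x - q‖) fun x₀ hx₀ => ?_
  have h1 := (hψ.contDiffAt (x := x₀)).hasStrictFDerivAt one_ne_zero
  have h2 := h1.isLittleO.def (half_pos hε)
  rw [nhds_prod_eq] at h2
  obtain ⟨r₁, hr₁, H₁⟩ := Metric.mem_nhds_iff.1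
    (show {p : E n × E n | ‖ψ p.1 - ψ p.2 - fderiv ℝ ψ x₀ (p.1 - p.2)‖ ≤ ε / 2 * ‖p.1 - p.2‖}
      ∈ 𝓝 (x₀, x₀) by rw [nhds_prod_eq]; exact h2)
  obtain ⟨r₂, hr₂, H₂⟩ := Metric.continuousAt_iff.1
    ((continuous_gradient hψ).continuousAt (x := x₀)) (ε / 2) (half_pos hε)
  refine ⟨min r₁ r₂, lt_min hr₁ hr₂, fun q hq x hx => ?_⟩
  have hq1 : dist q x₀ < r₁ := hq.2.trans_le (min_le_left _ _)
  have hx1 : dist x x₀ < r₁ := hx.2.trans_le (min_le_left _ _)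
  have h3 : |ψ x - ψ q - fderiv ℝ ψ x₀ (x - q)| ≤ ε / 2 * ‖x - q‖ :=
    H₁ (show (x, q) ∈ ball (x₀, x₀) r₁ by
      rw [mem_ball, Prod.dist_eq]; exact max_lt hx1 hq1)
  have h4 : ‖gradient ψ q - gradient ψ x₀‖ < ε / 2 := by
    rw [← dist_eq_norm]; exact H₂ (hq.2.trans_le (min_le_right _ _))
  have h5 : |⟪gradient ψ q - gradient ψ x₀, x - q⟫| ≤ ε / 2 * ‖x - q‖ :=
    (abs_real_inner_le_norm _ _).trans (by gcongr)
  rw [fderiv_eq_inner_gradient] at h3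
  rw [inner_sub_left] at h5
  rw [abs_le] at *
  constructor <;> linarith [h3.1, h3.2, h5.1, h5.2]

lemma exists_increment_le (h : IsSmoothBody K ν U) {α α' ε : ℝ} (hα0 : 0 < α)
    (hα : ∀ x ∈ frontier K, ∀ v ∈ (ℝ ∙ (ν x))ᗮ, α * ‖v‖ ^ 2 ≤ ⟪fderiv ℝ ν x v, v⟫)
    (hα'0 : 0 < α') (hαα : α' < α) {ψ : E n → ℝ} (hψ : ContDiff ℝ 1 ψ) (hε : 0 < ε) :
    ∃ δ > 0, ∃ t₀ > 0, ∀ t, 0 < t → t < t₀ → ∀ q ∈ frontier K, ∀ x ∈ frontier K, ‖x - q‖ < δ →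
      t * |ψ x - ψ q| - ⟪q - x, ν q⟫ ≤
        t ^ 2 * ((‖tproj (ν q) (gradient ψ q)‖ + ε) ^ 2 / (2 * α')) := by
  obtain ⟨β, hβ1, hβ2⟩ := exists_between hαα
  have hβ0 : 0 < β := hα'0.trans hβ1
  obtain ⟨δ₁, hδ₁, H₁⟩ := h.exists_quadratic hα0 hα hβ0 hβ2
  obtain ⟨δ₂, hδ₂, H₂⟩ := h.exists_gradient_expansion hψ hε
  obtain ⟨G, hG⟩ := h.isCompact_frontier.exists_bound_of_continuousOn
    (continuous_gradient hψ).continuousOn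
  set G' := max G 0 with hG'
  have hG'0 : 0 ≤ G' := le_max_right _ _
  refine ⟨min δ₁ δ₂, lt_min hδ₁ hδ₂, (1 - α' / β) / (G' + 1), div_pos
    (by rw [sub_pos, div_lt_one hβ0]; exact hβ1) (by positivity),
    fun t ht ht₀ q hq x hx hxq => ?_⟩
  have h1 := H₁ q hq x hx (hxq.trans_le (min_le_left _ _))
  have h2 := H₂ q hq x hx (by rw [norm_sub_rev]; exact hxq.trans_le (min_le_right _ _))
  have hν := h.unit q hq
  set g := gradient ψ q with hg
  set T := tproj (ν q) g with hT
  set u := x - q with hu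
  set ω := ⟪q - x, ν q⟫ with hω
  have hω0 : 0 ≤ ω := h.inner_sub_nonneg hq (h.frontier_subset hx)
  have h3 : ⟪g, u⟫ = ⟪T, u⟫ - ⟪ν q, g⟫ * ω := by
    have : ω = -⟪ν q, u⟫ := by rw [hω, hu, ← neg_sub x q, inner_neg_left, real_inner_comm]
    rw [this, hT, tproj_apply, inner_sub_left, inner_smul_left]
    simp only [RCLike.conj_to_real]; ring
  have h4 : |⟪T, u⟫| ≤ ‖T‖ * ‖u‖ := abs_real_inner_le_norm _ _
  have h5 : |⟪ν q, g⟫ * ω| ≤ G' * ω := by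
    rw [abs_mul, abs_of_nonneg hω0]
    refine mul_le_mul_of_nonneg_right ?_ hω0
    refine (abs_real_inner_le_norm _ _).trans ?_
    rw [hν, one_mul]
    exact (hG q hq).trans (le_max_left _ _)
  have h6 : |ψ x - ψ q| ≤ (‖T‖ + ε) * ‖u‖ + G' * ω := by
    rw [h3] at h2
    rw [abs_le] at *
    constructor <;> linarith [h2.1, h2.2, h4.1, h4.2, h5.1, h5.2]
  have h7 : α' / β ≤ 1 - t * G' := by
    have := (lt_div_iff₀ (by positivity)).1 ht₀
    linarith
  have h8 : α' / 2 * ‖u‖ ^ 2 ≤ (1 - t * G') * ω := by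
    calc α' / 2 * ‖u‖ ^ 2 = α' / β * (β / 2 * ‖u‖ ^ 2) := by field_simp
      _ ≤ (1 - t * G') * ω := by
        refine mul_le_mul h7 h1 (by positivity) ((by positivity : 0 ≤ α' / β).trans h7)
  have h9 : t * |ψ x - ψ q| ≤ t * ((‖T‖ + ε) * ‖u‖ + G' * ω) := by gcongr
  have h10 : t * ((‖T‖ + ε) * ‖u‖) - α' / 2 * ‖u‖ ^ 2 ≤ t ^ 2 * ((‖T‖ + ε) ^ 2 / (2 * α')) := by
    have : t ^ 2 * ((‖T‖ + ε) ^ 2 / (2 * α')) - (t * ((‖T‖ + ε) * ‖u‖) - α' / 2 * ‖u‖ ^ 2)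
        = (t * (‖T‖ + ε) - α' * ‖u‖) ^ 2 / (2 * α') := by field_simp; ring
    have h11 : 0 ≤ (t * (‖T‖ + ε) - α' * ‖u‖) ^ 2 / (2 * α') := by positivity
    linarith
  linarith

/-- Midpoints of points in two normal perturbations of a strictly convex body lie in a normal
perturbation of the mean width, up to a second-order term. -/
lemma exists_midpoint_mem_bump (h : IsSmoothBody K ν U) {α α' ε M : ℝ} (hα0 : 0 < α)
    (hα : ∀ x ∈ frontier K, ∀ v ∈ (ℝ ∙ (ν x))ᗮ, α * ‖v‖ ^ 2 ≤ ⟪fderiv ℝ ν x v, v⟫)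
    (hα'0 : 0 < α') (hαα : α' < α) {ψ : E n → ℝ} (hψ : ContDiff ℝ 1 ψ) (hε : 0 < ε)
    (hM0 : 0 < M) (hM : ∀ x ∈ frontier K, |ψ x| ≤ M) :
    ∃ t₀ > 0, ∀ t, 0 < t → t < t₀ → ∀ a ∈ bump K ν (fun x => t * (M + ψ x)),
      ∀ b ∈ bump K ν (fun x => t * (M - ψ x)), (2⁻¹ : ℝ) • (a + b) ∈
        bump K ν (fun x => t * M +
          t ^ 2 * ((‖tproj (ν x) (gradient ψ x)‖ + ε) ^ 2 / (2 * α'))) := by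
  obtain ⟨δ, hδ, t₁, ht₁, H⟩ := h.exists_increment_le hα0 hα hα'0 hαα hψ hε
  obtain ⟨κ, hκ, Hκ⟩ := h.exists_norm_lt hα0 hα hδ
  refine ⟨min t₁ (κ / (2 * M)), by positivity, fun t ht ht₀ a ha b hb => ?_⟩
  have htκ : 2 * (t * M) < κ := by
    have := (lt_div_iff₀ (by positivity)).1 (ht₀.trans_le (min_le_right _ _))
    linarith
  by_cases hz : (2⁻¹ : ℝ) • (a + b) ∈ K
  · exact Or.inl hz
  obtain ⟨q, hq, hd0, hd⟩ := h.exists_tube_eq hz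
  set d := infDist ((2⁻¹ : ℝ) • (a + b)) K with hd_def
  refine Or.inr ⟨(q, d), ⟨hq, hd0, ?_⟩, hd⟩
  change d ≤ t * M + t ^ 2 * ((‖tproj (ν q) (gradient ψ q)‖ + ε) ^ 2 / (2 * α'))
  set k := t ^ 2 * ((‖tproj (ν q) (gradient ψ q)‖ + ε) ^ 2 / (2 * α')) with hk
  have hk0 : 0 ≤ k := by positivity
  have hνq := h.unit q hq
  have hmid : 2 * d = ⟪a - q, ν q⟫ + ⟪b - q, ν q⟫ := by
    have h1 : a + b - (2 : ℝ) • q = (2 * d) • ν q := by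
      have h2 : a + b = (2 : ℝ) • tube ν (q, d) := by
        rw [hd, smul_smul]; norm_num
      rw [h2, tube]; module
    have h3 : ⟪a + b - (2 : ℝ) • q, ν q⟫ = 2 * d := by
      rw [h1, inner_smul_left, real_inner_self_eq_norm_sq, hνq]; simp
    rw [← h3, ← inner_add_left]; congr 1; module
  have hK : ∀ c ∈ K, ⟪c - q, ν q⟫ ≤ 0 := fun c hc => by
    have := h.inner_sub_nonneg hq hc
    rw [← neg_sub c q, inner_neg_left] at this; linarith
  have hT : ∀ x ∈ frontier K, ∀ s, 0 < s → ⟪tube ν (x, s) - q, ν q⟫ ≤ s - ⟪q - x, ν q⟫ := by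
    intro x hx s hs
    have h1 : tube ν (x, s) - q = s • ν x - (q - x) := by rw [tube]; module
    rw [h1, inner_sub_left, inner_smul_left]
    simp only [RCLike.conj_to_real]
    have h2 : ⟪ν x, ν q⟫ ≤ 1 := by
      have := real_inner_le_norm (ν x) (ν q)
      rwa [h.unit x hx, hνq, one_mul] at this
    have h3 := mul_le_mul_of_nonneg_left h2 hs.le
    linarith
  have hω : ∀ x ∈ frontier K, 0 ≤ ⟪q - x, ν q⟫ := fun x hx =>
    h.inner_sub_nonneg hq (h.frontier_subset hx)
  have hψt : ∀ x ∈ frontier K, |t * ψ x| ≤ t * M := fun x hx => by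
    rw [abs_mul, abs_of_pos ht]; exact mul_le_mul_of_nonneg_left (hM x hx) ht.le
  by_contra! hlt
  rcases ha with ha | ⟨⟨x, s⟩, ⟨hx, hs0, hs⟩, rfl⟩
  · rcases hb with hb | ⟨⟨y, r⟩, ⟨hy, hr0, hr⟩, rfl⟩
    · linarith [hK a ha, hK b hb]
    · have := hψt y hy
      simp only at hr hr0 hy
      linarith [hK a ha, hT y hy r hr0, hω y hy, (abs_le.1 this).1]
  · simp only at hs hs0 hx
    have hψx := abs_le.1 (hψt x hx)
    rcases hb with hb | ⟨⟨y, r⟩, ⟨hy, hr0, hr⟩, rfl⟩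
    · linarith [hK b hb, hT x hx s hs0, hω x hx]
    · simp only at hr hr0 hy
      have hψy := abs_le.1 (hψt y hy)
      have h1 := hT x hx s hs0
      have h2 := hT y hy r hr0
      have hsum : ⟪q - x, ν q⟫ + ⟪q - y, ν q⟫ < 2 * (t * M) := by linarith
      have h3 := H t ht (ht₀.trans_le (min_le_left _ _)) q hq x hx
        (Hκ q hq x hx (by linarith [hω y hy]))
      have h4 := H t ht (ht₀.trans_le (min_le_left _ _)) q hq y hy
        (Hκ q hq y hy (by linarith [hω x hx]))
      have h5 := mul_le_mul_of_nonneg_left (le_abs_self (ψ x - ψ q)) ht.le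
      have h6 := mul_le_mul_of_nonneg_left (neg_abs_le (ψ y - ψ q)) ht.le
      linarith

end IsSmoothBody

lemma setLIntegral_Ioc_ofReal_affine {a m : ℝ} (ha : 0 ≤ a) (hm : 0 ≤ m) :
    ∫⁻ s in Set.Ioc 0 a, ENNReal.ofReal (1 + s * m) = ENNReal.ofReal (a + m / 2 * a ^ 2) := by
  have hintg : IntervalIntegrable (fun s : ℝ => 1 + s * m) volume 0 a :=
    (by fun_prop : Continuous fun s : ℝ => 1 + s * m).intervalIntegrable _ _
  rw [← ofReal_integral_eq_lintegral_ofReal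
      ((intervalIntegrable_iff_integrableOn_Ioc_of_le ha).1 hintg)
      ((ae_restrict_iff' measurableSet_Ioc).2 (ae_of_all _ fun s hs =>
        add_nonneg zero_le_one (mul_nonneg hs.1.le hm))),
    ← intervalIntegral.integral_of_le ha,
    intervalIntegral.integral_add (by simp) (by
      exact (by fun_prop : Continuous fun s : ℝ => s * m).intervalIntegrable _ _),
    intervalIntegral.integral_mul_const, integral_id]
  congr 1
  simp
  ring

namespace IsSmoothBody

variable {n : ℕ} {K : Set (E n)} {ν : E n → E n} {U : Set (E n)} {c : ℝ≥0∞}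

lemma ae_mem_frontier (h : IsSmoothBody K ν U) : ∀ᵐ x ∂surf c K, x ∈ frontier K :=
  Measure.ae_smul_measure (ae_restrict_mem h.isCompact_frontier.measurableSet) c

lemma aemeasurable_surf {β : Type*} [TopologicalSpace β] [MeasurableSpace β] [BorelSpace β]
    (h : IsSmoothBody K ν U) {f : E n → β} (hf : ContinuousOn f (frontier K)) :
    AEMeasurable f (surf c K) :=
  (hf.aemeasurable h.isCompact_frontier.measurableSet).smul_measure c

lemma integrable_surf (h : IsSmoothBody K ν U) [IsFiniteMeasure (surf c K)] {f : E n → ℝ}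
    (hf : ContinuousOn f (frontier K)) : Integrable f (surf c K) := by
  obtain ⟨B, hB⟩ := h.isCompact_frontier.exists_bound_of_continuousOn hf
  exact Integrable.of_bound (h.aemeasurable_surf hf).aestronglyMeasurable B
    (h.ae_mem_frontier.mono fun x hx => hB x hx)

lemma measurableSet_layer {f : E n → ℝ}
    (hf : ContinuousOn f (frontier K)) :
    MeasurableSet {p : E n × ℝ | p.1 ∈ frontier K ∧ 0 < p.2 ∧ p.2 ≤ f p.1} := by
  have hS : IsClosed (frontier K ×ˢ (Set.univ : Set ℝ)) := isClosed_frontier.prod isClosed_univ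
  have hg : ContinuousOn (fun p : E n × ℝ => f p.1 - p.2) (frontier K ×ˢ Set.univ) :=
    (hf.comp continuousOn_fst fun p hp => hp.1).sub continuousOn_snd
  have h1 := (hg.preimage_isClosed_of_isClosed hS isClosed_Ici (t := Set.Ici 0)).measurableSet
  have h2 : MeasurableSet {p : E n × ℝ | 0 < p.2} := measurableSet_lt measurable_const measurable_snd
  convert h1.inter h2 using 1
  ext p
  simp only [Set.mem_ofPred_eq, Set.mem_inter_iff, Set.mem_prod, Set.mem_univ, and_true,
    Set.mem_preimage, Set.mem_Ici, sub_nonneg]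
  tauto

lemma layer_subset (f : E n → ℝ) :
    {p : E n × ℝ | p.1 ∈ frontier K ∧ 0 < p.2 ∧ p.2 ≤ f p.1} ⊆ frontier K ×ˢ Set.Ici 0 :=
  fun _ hp => ⟨hp.1, hp.2.1.le⟩

lemma measurableSet_tube_layer (h : IsSmoothBody K ν U) {f : E n → ℝ}
    (hf : ContinuousOn f (frontier K)) :
    MeasurableSet (tube ν '' {p : E n × ℝ | p.1 ∈ frontier K ∧ 0 < p.2 ∧ p.2 ≤ f p.1}) :=
  (measurableSet_layer hf).image_of_continuousOn_injOn
    (h.continuousOn_tube.mono fun _ hp => ⟨hp.1, trivial⟩) (h.injOn_tube.mono (layer_subset f))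

lemma measurableSet_bump (h : IsSmoothBody K ν U) {f : E n → ℝ}
    (hf : ContinuousOn f (frontier K)) : MeasurableSet (bump K ν f) :=
  h.comp.measurableSet.union (h.measurableSet_tube_layer hf)

lemma volume_bump (h : IsSmoothBody K ν U) (hn : 1 ≤ n) [IsFiniteMeasure (surf c K)]
    (hc : IsSlicing n c) {f : E n → ℝ} (hf : ContinuousOn f (frontier K)) :
    volume (bump K ν f) = volume K +
      ∫⁻ x, (∫⁻ s in Set.Ioc 0 (f x), ENNReal.ofReal (jac ν (x, s))) ∂surf c K := by
  set Q := {p : E n × ℝ | p.1 ∈ frontier K ∧ 0 < p.2 ∧ p.2 ≤ f p.1} with hQ_def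
  have hQ : MeasurableSet Q := measurableSet_layer hf
  obtain ⟨B, hB⟩ := h.isCompact_frontier.exists_bound_of_continuousOn hf
  have hQf : ((surf c K).prod volume) Q ≠ ∞ := by
    have h1 : Q ⊆ Set.univ ×ˢ Set.Ioc 0 B := fun p hp =>
      ⟨trivial, hp.2.1, hp.2.2.trans ((le_abs_self _).trans (hB p.1 hp.1))⟩
    refine ne_top_of_le_ne_top ?_ (measure_mono h1)
    rw [Measure.prod_prod, Real.volume_Ioc]
    exact ENNReal.mul_ne_top (measure_ne_top _ _) ENNReal.ofReal_ne_top
  have hdisj : Disjoint K (tube ν '' Q) := by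
    rw [Set.disjoint_left]
    rintro _ hz ⟨⟨x, s⟩, hp, rfl⟩
    exact h.tube_notMem hp.1 hp.2.1 hz
  rw [bump, measure_union hdisj (h.measurableSet_tube_layer hf),
    h.volume_tube_image hn hc hQ (layer_subset f) hQf]
  congr 1
  have hj : AEMeasurable (fun p => ENNReal.ofReal (jac ν p)) (((surf c K).prod volume).restrict Q) :=
    ((h.continuousOn_jac.mono fun _ hp => ⟨hp.1, trivial⟩).aemeasurable hQ).ennreal_ofReal
  rw [← lintegral_indicator hQ, lintegral_prod _ ((aemeasurable_indicator_iff hQ).2 hj)]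
  refine lintegral_congr_ae (h.ae_mem_frontier.mono fun x hx => ?_)
  dsimp only
  rw [← lintegral_indicator measurableSet_Ioc]
  refine lintegral_congr fun s => ?_
  by_cases hs : s ∈ Set.Ioc 0 (f x)
  · rw [Set.indicator_of_mem hs, Set.indicator_of_mem (show (x, s) ∈ Q from ⟨hx, hs.1, hs.2⟩)]
  · rw [Set.indicator_of_notMem hs, Set.indicator_of_notMem fun hp : (x, s) ∈ Q =>
      hs ⟨hp.2.1, hp.2.2⟩]

/-- Second-order Steiner-type expansion of the volume of a thin normal perturbation. -/
lemma exists_volume_bump_bounds (h : IsSmoothBody K ν U) (hn : 1 ≤ n) [IsFiniteMeasure (surf c K)]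
    (hc : IsSlicing n c) {η : ℝ} (hη : 0 < η) (hH : ∀ x ∈ frontier K, η ≤ meanCurv ν x) :
    ∃ r > 0, ∀ f : E n → ℝ, ContinuousOn f (frontier K) → (∀ x ∈ frontier K, 0 ≤ f x ∧ f x < r) →
      volume (bump K ν f) ≠ ∞ ∧
      volume.real K + ∫ x, (f x + (meanCurv ν x - η) / 2 * f x ^ 2) ∂surf c K
        ≤ volume.real (bump K ν f) ∧
      volume.real (bump K ν f)
        ≤ volume.real K + ∫ x, (f x + (meanCurv ν x + η) / 2 * f x ^ 2) ∂surf c K := by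
  obtain ⟨r, hr, H⟩ := h.exists_jac_expansion hη
  refine ⟨r, hr, fun f hf hfr => ?_⟩
  have hKfin : volume K ≠ ∞ := h.comp.measure_lt_top.ne
  have hcont : ∀ m : ℝ, ContinuousOn (fun x => f x + (meanCurv ν x + m) / 2 * f x ^ 2)
      (frontier K) := fun m =>
    hf.add (((h.continuousOn_meanCurv.add continuousOn_const).div_const 2).mul (hf.pow 2))
  have hnn : ∀ m : ℝ, -η ≤ m → 0 ≤ᵐ[surf c K] fun x => f x + (meanCurv ν x + m) / 2 * f x ^ 2 :=
    fun m hm => h.ae_mem_frontier.mono fun x hx =>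
      add_nonneg (hfr x hx).1 (mul_nonneg (by linarith [hH x hx]) (sq_nonneg _))
  have hlint : ∀ m : ℝ, -η ≤ m →
      ∫⁻ x, (∫⁻ s in Set.Ioc 0 (f x), ENNReal.ofReal (1 + s * (meanCurv ν x + m))) ∂surf c K
        = ENNReal.ofReal (∫ x, (f x + (meanCurv ν x + m) / 2 * f x ^ 2) ∂surf c K) := by
    intro m hm
    rw [ofReal_integral_eq_lintegral_ofReal (h.integrable_surf (hcont m)) (hnn m hm)]
    exact lintegral_congr_ae (h.ae_mem_frontier.mono fun x hx =>
      setLIntegral_Ioc_ofReal_affine (hfr x hx).1 (by linarith [hH x hx]))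
  set J := ∫⁻ x, (∫⁻ s in Set.Ioc 0 (f x), ENNReal.ofReal (jac ν (x, s))) ∂surf c K with hJ
  have hlow : ENNReal.ofReal (∫ x, (f x + (meanCurv ν x - η) / 2 * f x ^ 2) ∂surf c K) ≤ J := by
    have := hlint (-η) le_rfl
    simp only [← sub_eq_add_neg] at this
    rw [← this]
    refine lintegral_mono_ae (h.ae_mem_frontier.mono fun x hx =>
      setLIntegral_mono' measurableSet_Ioc fun s hs => ENNReal.ofReal_le_ofReal ?_)
    have := (abs_le.1 (H x hx s hs.1.le (hs.2.trans_lt (hfr x hx).2))).1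
    linarith
  have hupp : J ≤ ENNReal.ofReal (∫ x, (f x + (meanCurv ν x + η) / 2 * f x ^ 2) ∂surf c K) := by
    rw [← hlint η (by linarith)]
    refine lintegral_mono_ae (h.ae_mem_frontier.mono fun x hx =>
      setLIntegral_mono' measurableSet_Ioc fun s hs => ENNReal.ofReal_le_ofReal ?_)
    have := (abs_le.1 (H x hx s hs.1.le (hs.2.trans_lt (hfr x hx).2))).2
    linarith
  have hJfin : J ≠ ∞ := ne_top_of_le_ne_top ENNReal.ofReal_ne_top hupp
  have hvol : volume (bump K ν f) = volume K + J := h.volume_bump hn hc hf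
  have hreal : volume.real (bump K ν f) = volume.real K + J.toReal := by
    rw [measureReal_def, hvol, ENNReal.toReal_add hKfin hJfin, measureReal_def]
  refine ⟨by rw [hvol]; exact ENNReal.add_ne_top.2 ⟨hKfin, hJfin⟩, ?_, ?_⟩
  · rw [hreal]
    gcongr
    exact (ENNReal.ofReal_le_iff_le_toReal hJfin).1 hlow
  · rw [hreal]
    gcongr
    exact ENNReal.toReal_le_of_le_ofReal (integral_nonneg_of_ae (hnn η (by linarith))) hupp

end IsSmoothBody

lemma le_of_forall_small {f : ℝ → ℝ} (hf : Continuous f) {x t₀ : ℝ} (ht₀ : 0 < t₀)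
    (H : ∀ t, 0 < t → t < t₀ → x ≤ f t) : x ≤ f 0 := by
  have hlim : Tendsto f (𝓝[>] 0) (𝓝 (f 0)) :=
    hf.continuousAt.tendsto.mono_left nhdsWithin_le_nhds
  refine ge_of_tendsto hlim ?_
  filter_upwards [Ioo_mem_nhdsGT ht₀] with t ht using H t ht.1 ht.2

lemma add_le_two_mul_of_forall_small {V m a b c d t₀ : ℝ} (hV : 0 < V) (hm : 0 ≤ m) (ha : 0 ≤ a)
    (hb : 0 ≤ b) (ht₀ : 0 < t₀)
    (H : ∀ t, 0 < t → t < t₀ → (V + t * m + t ^ 2 * a) * (V + t * m + t ^ 2 * b)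
      ≤ (V + t * m + t ^ 2 * (c + t * d)) ^ 2) : a + b ≤ 2 * c := by
  have key := le_of_forall_small (x := a + b)
    (f := fun t : ℝ => 2 * (c + t * d) + t ^ 2 * ((c + t * d) ^ 2 / V)) (by fun_prop) ht₀
    fun t ht htt => by
    have h1 := H t ht htt
    set W := V + t * m with hW
    set e := c + t * d with he
    have hVW : V ≤ W := by
      have : 0 ≤ t * m := by positivity
      linarith
    have hW0 : 0 < W := hV.trans_le hVW
    have h2 : 0 ≤ t ^ 2 * a * (t ^ 2 * b) := by positivity
    have h3 : (W * t ^ 2) * (a + b) ≤ (W * t ^ 2) * (2 * e + t ^ 2 * (e ^ 2 / W)) := by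
      have : (W * t ^ 2) * (2 * e + t ^ 2 * (e ^ 2 / W)) = 2 * W * t ^ 2 * e + t ^ 4 * e ^ 2 := by
        field_simp
      rw [this]
      linarith
    have h4 := le_of_mul_le_mul_left h3 (by positivity)
    have h5 : t ^ 2 * (e ^ 2 / W) ≤ t ^ 2 * (e ^ 2 / V) := by gcongr
    exact h4.trans (by linarith)
  simpa using key

namespace IsSmoothBody

variable {n : ℕ} {K : Set (E n)} {ν : E n → E n} {U : Set (E n)} {c : ℝ≥0∞}

lemma volume_real_pos (h : IsSmoothBody K ν U) : 0 < volume.real K :=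
  ENNReal.toReal_pos ((isOpen_interior.measure_pos _ h.int).trans_le
    (measure_mono interior_subset)).ne' h.comp.measure_lt_top.ne

set_option maxHeartbeats 800000 in
lemma second_variation (h : IsSmoothBody K ν U) (hn : 1 ≤ n) [IsFiniteMeasure (surf c K)]
    (hc : IsSlicing n c) {α α' ε M η : ℝ} (hα0 : 0 < α)
    (hα : ∀ x ∈ frontier K, ∀ v ∈ (ℝ ∙ (ν x))ᗮ, α * ‖v‖ ^ 2 ≤ ⟪fderiv ℝ ν x v, v⟫)
    (hα'0 : 0 < α') (hαα : α' < α) {ψ : E n → ℝ} (hψ : ContDiff ℝ 1 ψ) (hε : 0 < ε)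
    (hM0 : 0 < M) (hM : ∀ x ∈ frontier K, |ψ x| ≤ M) (hη : 0 < η)
    (hH : ∀ x ∈ frontier K, η ≤ meanCurv ν x) (hmean : ∫ x, ψ x ∂surf c K = 0) :
    ∫ x, meanCurv ν x * ψ x ^ 2 ∂surf c K ≤
      2 * ∫ x, (‖tproj (ν x) (gradient ψ x)‖ + ε) ^ 2 / (2 * α') ∂surf c K
        + η * ∫ x, (2 * M ^ 2 + ψ x ^ 2) ∂surf c K := by
  set σ := surf c K with hσ
  set Hc := meanCurv ν with hHc
  set k : E n → ℝ := fun x => (‖tproj (ν x) (gradient ψ x)‖ + ε) ^ 2 / (2 * α') with hk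
  have hψc : ContinuousOn ψ (frontier K) := hψ.continuous.continuousOn
  have hHcc : ContinuousOn Hc (frontier K) := h.continuousOn_meanCurv
  have hkc : ContinuousOn k (frontier K) :=
    (((h.continuousOn_tgrad hψ).norm.add continuousOn_const).pow 2).div_const _
  have hk0 : ∀ x, 0 ≤ k x := fun x => by positivity
  obtain ⟨t₁, ht₁, Hmid⟩ := h.exists_midpoint_mem_bump hα0 hα hα'0 hαα hψ hε hM0 hM
  obtain ⟨r, hr, Hvol⟩ := h.exists_volume_bump_bounds hn hc hη hH
  obtain ⟨k₁, hk₁⟩ := h.isCompact_frontier.exists_bound_of_continuousOn hkc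
  set k₂ := max k₁ 0 with hk₂
  have hk₂0 : 0 ≤ k₂ := le_max_right _ _
  have hkk : ∀ x ∈ frontier K, k x ≤ k₂ := fun x hx =>
    (le_abs_self _).trans ((hk₁ x hx).trans (le_max_left _ _))
  set pa : E n → ℝ := fun x => (Hc x - η) / 2 * (M + ψ x) ^ 2 with hpa
  set pb : E n → ℝ := fun x => (Hc x - η) / 2 * (M - ψ x) ^ 2 with hpb
  set pc : E n → ℝ := fun x => k x + (Hc x + η) / 2 * M ^ 2 with hpc
  set pd : E n → ℝ := fun x => (Hc x + η) / 2 * (2 * M * k x + k x ^ 2) with hpd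
  have hpac : ContinuousOn pa (frontier K) := by fun_prop
  have hpbc : ContinuousOn pb (frontier K) := by fun_prop
  have hpcc : ContinuousOn pc (frontier K) := by fun_prop
  have hpdc : ContinuousOn pd (frontier K) := by fun_prop
  have ipa := h.integrable_surf (c := c) hpac
  have ipb := h.integrable_surf (c := c) hpbc
  have ipc := h.integrable_surf (c := c) hpcc
  have ipd := h.integrable_surf (c := c) hpdc
  have iψ := h.integrable_surf (c := c) hψc
  have hmain : ∫ x, pa x ∂σ + ∫ x, pb x ∂σ ≤ 2 * ∫ x, pc x ∂σ := by
    refine add_le_two_mul_of_forall_small (V := volume.real K) (m := ∫ _, M ∂σ)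
      (d := ∫ x, pd x ∂σ) (t₀ := min (min t₁ 1) (r / (2 * M + k₂))) h.volume_real_pos
      (integral_nonneg fun _ => hM0.le)
      (integral_nonneg_of_ae (h.ae_mem_frontier.mono fun x hx =>
        mul_nonneg (by linarith [hH x hx]) (sq_nonneg _)))
      (integral_nonneg_of_ae (h.ae_mem_frontier.mono fun x hx =>
        mul_nonneg (by linarith [hH x hx]) (sq_nonneg _))) (by positivity) fun t ht htt => ?_
    have htt₁ : t < t₁ := htt.trans_le ((min_le_left _ _).trans (min_le_left _ _))
    have ht1 : t < 1 := htt.trans_le ((min_le_left _ _).trans (min_le_right _ _))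
    have htr : t * (2 * M + k₂) < r :=
      (lt_div_iff₀ (by positivity)).1 (htt.trans_le (min_le_right _ _))
    have htk : t * k₂ ≥ 0 := by positivity
    set fa : E n → ℝ := fun x => t * (M + ψ x) with hfa
    set fb : E n → ℝ := fun x => t * (M - ψ x) with hfb
    set fc : E n → ℝ := fun x => t * M + t ^ 2 * k x with hfc
    have hfac : ContinuousOn fa (frontier K) := by fun_prop
    have hfbc : ContinuousOn fb (frontier K) := by fun_prop
    have hfcc : ContinuousOn fc (frontier K) := by fun_prop
    have hψt : ∀ x ∈ frontier K, |t * ψ x| ≤ t * M := fun x hx => by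
      rw [abs_mul, abs_of_pos ht]; exact mul_le_mul_of_nonneg_left (hM x hx) ht.le
    obtain ⟨-, hA, -⟩ := Hvol fa hfac fun x hx => by
      have := abs_le.1 (hψt x hx)
      constructor <;> simp only [hfa] <;> linarith
    obtain ⟨-, hB, -⟩ := Hvol fb hfbc fun x hx => by
      have := abs_le.1 (hψt x hx)
      constructor <;> simp only [hfb] <;> linarith
    obtain ⟨hCfin, -, hC⟩ := Hvol fc hfcc fun x hx => by
      constructor
      · have := hk0 x; simp only [hfc]; positivity
      · have h1 : t ^ 2 * k x ≤ t * k₂ := by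
          calc t ^ 2 * k x ≤ t ^ 2 * k₂ := by gcongr; exact hkk x hx
            _ = t * (t * k₂) := by ring
            _ ≤ t * (1 * k₂) := by gcongr
            _ = t * k₂ := by ring
        have : 0 < t * M := by positivity
        simp only [hfc]; linarith
    have hBM := volume_mul_volume_le_sq (h.measurableSet_bump hfac) (h.measurableSet_bump hfbc)
      (h.measurableSet_bump hfcc) fun a ha b hb => Hmid t ht htt₁ a ha b hb
    have hBMr : volume.real (bump K ν fa) * volume.real (bump K ν fb)
        ≤ volume.real (bump K ν fc) ^ 2 := by
      simp only [measureReal_def]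
      rw [← ENNReal.toReal_mul, ← ENNReal.toReal_pow]
      exact ENNReal.toReal_mono (ENNReal.pow_ne_top hCfin) hBM
    have ea : ∫ x, (fa x + (Hc x - η) / 2 * fa x ^ 2) ∂σ
        = t * ∫ _, M ∂σ + t ^ 2 * ∫ x, pa x ∂σ := by
      have : (fun x => fa x + (Hc x - η) / 2 * fa x ^ 2)
          = fun x => t * (M + ψ x) + t ^ 2 * pa x := by
        funext x; simp only [hfa, hpa]; ring
      have i1 : Integrable (fun x => M + ψ x) σ := (integrable_const M).add iψ
      rw [this, integral_add (i1.const_mul t) (ipa.const_mul _), integral_const_mul, integral_const_mul, integral_add (integrable_const M) iψ, hmean,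
        add_zero]
    have eb : ∫ x, (fb x + (Hc x - η) / 2 * fb x ^ 2) ∂σ
        = t * ∫ _, M ∂σ + t ^ 2 * ∫ x, pb x ∂σ := by
      have : (fun x => fb x + (Hc x - η) / 2 * fb x ^ 2)
          = fun x => t * (M - ψ x) + t ^ 2 * pb x := by
        funext x; simp only [hfb, hpb]; ring
      have i1 : Integrable (fun x => M - ψ x) σ := (integrable_const M).sub iψ
      rw [this, integral_add (i1.const_mul t) (ipb.const_mul _), integral_const_mul, integral_const_mul, integral_sub (integrable_const M) iψ, hmean,
        sub_zero]
    have ec : ∫ x, (fc x + (Hc x + η) / 2 * fc x ^ 2) ∂σ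
        ≤ t * ∫ _, M ∂σ + t ^ 2 * (∫ x, pc x ∂σ + t * ∫ x, pd x ∂σ) := by
      have e1 : t * ∫ _, M ∂σ + t ^ 2 * (∫ x, pc x ∂σ + t * ∫ x, pd x ∂σ)
          = ∫ x, (t * M + t ^ 2 * (pc x + t * pd x)) ∂σ := by
        have i1 : Integrable (fun x => pc x + t * pd x) σ := ipc.add (ipd.const_mul t)
        rw [integral_add ((integrable_const M).const_mul t) (i1.const_mul _), integral_const_mul, integral_const_mul,
          integral_add ipc (ipd.const_mul t), integral_const_mul]
      rw [e1]
      refine integral_mono_ae (h.integrable_surf (by fun_prop)) (h.integrable_surf (by fun_prop))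
        (h.ae_mem_frontier.mono fun x hx => ?_)
      have hHx : 0 ≤ (Hc x + η) / 2 := by linarith [hH x hx]
      have h1 : (t * M + t ^ 2 * k x) ^ 2
          ≤ t ^ 2 * (M ^ 2 + t * (2 * M * k x + k x ^ 2)) := by
        have h2 : 0 ≤ t ^ 3 * k x ^ 2 * (1 - t) :=
          mul_nonneg (by positivity) (by linarith)
        linarith
      have h2 := mul_le_mul_of_nonneg_left h1 hHx
      simp only [hfc, hpc, hpd]
      linarith
    rw [ea] at hA
    rw [eb] at hB
    have hpos : 0 ≤ volume.real K + t * ∫ _, M ∂σ := by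
      have : 0 ≤ ∫ _, M ∂σ := integral_nonneg fun _ => hM0.le
      positivity
    have hpa0 : 0 ≤ ∫ x, pa x ∂σ := integral_nonneg_of_ae (h.ae_mem_frontier.mono fun x hx =>
        mul_nonneg (by linarith [hH x hx]) (sq_nonneg _))
    have hpb0 : 0 ≤ ∫ x, pb x ∂σ := integral_nonneg_of_ae (h.ae_mem_frontier.mono fun x hx =>
        mul_nonneg (by linarith [hH x hx]) (sq_nonneg _))
    calc _ ≤ volume.real (bump K ν fa) * volume.real (bump K ν fb) :=
          mul_le_mul (by linarith) (by linarith)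
            (add_nonneg hpos (mul_nonneg (sq_nonneg _) hpb0)) measureReal_nonneg
      _ ≤ volume.real (bump K ν fc) ^ 2 := hBMr
      _ ≤ _ := pow_le_pow_left₀ measureReal_nonneg (by linarith) 2
  have i1 : Integrable (fun x => Hc x * ψ x ^ 2) σ := h.integrable_surf (by fun_prop)
  have i2 : Integrable k σ := h.integrable_surf hkc
  have i3 : Integrable (fun x => 2 * M ^ 2 + ψ x ^ 2) σ := h.integrable_surf (by fun_prop)
  have i4 : Integrable (fun x => pa x + pb x) σ := ipa.add ipb
  have i5 : Integrable (fun x => Hc x * ψ x ^ 2 - 2 * k x) σ := i1.sub (i2.const_mul 2)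
  have e2 : ∫ x, pa x ∂σ + ∫ x, pb x ∂σ - 2 * ∫ x, pc x ∂σ
      = ∫ x, Hc x * ψ x ^ 2 ∂σ - 2 * ∫ x, k x ∂σ - η * ∫ x, (2 * M ^ 2 + ψ x ^ 2) ∂σ := by
    rw [← integral_const_mul, ← integral_const_mul, ← integral_const_mul, ← integral_add ipa ipb,
      ← integral_sub i4 (ipc.const_mul 2), ← integral_sub i1 (i2.const_mul 2),
      ← integral_sub i5 (i3.const_mul η)]
    congr 1
    funext x
    simp only [hpa, hpb, hpc]
    ring
  linarith

lemma poincare_surf (h : IsSmoothBody K ν U) (hn : 2 ≤ n) [IsFiniteMeasure (surf c K)]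
    (hc : IsSlicing n c) {α : ℝ} (hα0 : 0 < α)
    (hα : ∀ x ∈ frontier K, ∀ v ∈ (ℝ ∙ (ν x))ᗮ, α * ‖v‖ ^ 2 ≤ ⟪fderiv ℝ ν x v, v⟫)
    {ψ : E n → ℝ} (hψ : ContDiff ℝ 1 ψ) (hmean : ∫ x, ψ x ∂surf c K = 0) :
    ((n : ℝ) - 1) * α ^ 2 * ∫ x, ψ x ^ 2 ∂surf c K
      ≤ ∫ x, ‖tproj (ν x) (gradient ψ x)‖ ^ 2 ∂surf c K := by
  have hψc : ContinuousOn ψ (frontier K) := hψ.continuous.continuousOn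
  have hn1 : (0 : ℝ) < n - 1 := by
    have : (2 : ℝ) ≤ n := by exact_mod_cast hn
    linarith
  have hH : ∀ x ∈ frontier K, ((n : ℝ) - 1) * α ≤ meanCurv ν x := fun x hx =>
    h.le_meanCurv hx (hα x hx)
  obtain ⟨B, hB⟩ := h.isCompact_frontier.exists_bound_of_continuousOn hψc
  have hTc := (h.continuousOn_tgrad hψ).norm
  have hHcc := h.continuousOn_meanCurv
  set T : E n → ℝ := fun x => ‖tproj (ν x) (gradient ψ x)‖ with hT
  set σ := surf c K with hσ
  have h1 : ∀ α' ε : ℝ, 0 < α' → α' < α → 0 < ε →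
      ∫ x, meanCurv ν x * ψ x ^ 2 ∂σ ≤ 2 * ∫ x, (T x + ε) ^ 2 / (2 * α') ∂σ := by
    intro α' ε h0 h1 hε
    have key : ∫ x, meanCurv ν x * ψ x ^ 2 ∂σ ≤
        (fun η => 2 * ∫ x, (T x + ε) ^ 2 / (2 * α') ∂σ
          + η * ∫ x, (2 * (max B 1) ^ 2 + ψ x ^ 2) ∂σ) 0 :=
      le_of_forall_small (by fun_prop) (mul_pos hn1 hα0) fun η hη hη' =>
        h.second_variation (by omega) hc hα0 hα h0 h1 hψ hε (by positivity)
          (fun x hx => (hB x hx).trans (le_max_left _ _)) hη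
          (fun x hx => hη'.le.trans (hH x hx)) hmean
    simpa using key
  have h2 : ((n : ℝ) - 1) * α * ∫ x, ψ x ^ 2 ∂σ ≤ ∫ x, meanCurv ν x * ψ x ^ 2 ∂σ := by
    rw [← integral_const_mul]
    exact integral_mono_ae (h.integrable_surf (by fun_prop)) (h.integrable_surf (by fun_prop))
      (h.ae_mem_frontier.mono fun x hx => mul_le_mul_of_nonneg_right (hH x hx) (sq_nonneg _))
  have h3 : ∀ α' ε : ℝ, 0 < α' → α' < α → 0 < ε →
      α' * (((n : ℝ) - 1) * α * ∫ x, ψ x ^ 2 ∂σ)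
        ≤ ∫ x, T x ^ 2 ∂σ + ε * ∫ x, 2 * T x ∂σ + ε ^ 2 * ∫ _, 1 ∂σ := by
    intro α' ε h0 h4 hε
    have h5 : ∫ x, T x ^ 2 ∂σ + ε * ∫ x, 2 * T x ∂σ + ε ^ 2 * ∫ _, 1 ∂σ
        = α' * (2 * ∫ x, (T x + ε) ^ 2 / (2 * α') ∂σ) := by
      have i1 : Integrable (fun x => T x ^ 2) σ := h.integrable_surf (by fun_prop)
      have i2 : Integrable (fun x => ε * (2 * T x)) σ := h.integrable_surf (by fun_prop)
      have i4 : Integrable (fun x => T x ^ 2 + ε * (2 * T x)) σ := i1.add i2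
      have i3 : Integrable (fun _ => ε ^ 2 * (1 : ℝ)) σ := integrable_const _
      rw [← integral_const_mul, ← integral_const_mul, ← integral_const_mul, ← integral_const_mul,
        ← integral_add i1 i2, ← integral_add i4 i3]
      congr 1
      funext x
      field_simp
      ring
    rw [h5]
    exact mul_le_mul_of_nonneg_left (h2.trans (h1 α' ε h0 h4 hε)) h0.le
  have h4 : ∀ α' : ℝ, 0 < α' → α' < α →
      α' * (((n : ℝ) - 1) * α * ∫ x, ψ x ^ 2 ∂σ) ≤ ∫ x, T x ^ 2 ∂σ := by
    intro α' h0 h5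
    have key := le_of_forall_small
      (f := fun ε => ∫ x, T x ^ 2 ∂σ + ε * ∫ x, 2 * T x ∂σ + ε ^ 2 * ∫ _, 1 ∂σ) (by fun_prop)
      one_pos fun ε hε _ => h3 α' ε h0 h5 hε
    simpa using key
  have h5 := le_of_forall_small (x := 0)
    (f := fun t => ∫ x, T x ^ 2 ∂σ - (α - t) * (((n : ℝ) - 1) * α * ∫ x, ψ x ^ 2 ∂σ))
    (by fun_prop) hα0 fun t ht ht' => by
      have := h4 (α - t) (by linarith) (by linarith)
      linarith
  simp only [sub_zero] at h5
  linarith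

end IsSmoothBody

end

/-- Poincaré inequality on the boundary of a convex body of class `C²₊` (inequality (4)
of the paper):  Let `K ⊂ ℝⁿ` be a convex body of class `C²₊` (compact convex set with
nonempty interior, whose outer unit normal field `ν` is `C¹` near `∂K`, with positive
definite Weingarten map), and let `α > 0` be such that all principal curvatures of `∂K`
are `≥ α` at every point, i.e. `⟨Dν v, v⟩ ≥ α ‖v‖²` for all tangent vectors `v`.  Then
for every `ψ ∈ C¹(∂K)` (represented by a `C¹` extension) with `∫_{∂K} ψ dℋ^{n-1} = 0`,
`(n-1) α² ∫_{∂K} ψ² dℋ^{n-1} ≤ ∫_{∂K} |∇ψ|² dℋ^{n-1}`,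
where `∇ψ x = tproj (ν x) (gradient ψ x)` is the tangential gradient of `ψ` on `∂K`. -/
theorem convex_body_poincare
    {n : ℕ} (hn : 2 ≤ n) (K : Set (E n))
    (hKconv : Convex ℝ K) (hKcomp : IsCompact K) (hKint : (interior K).Nonempty)
    (ν : E n → E n) (U : Set (E n)) (hU : IsOpen U) (hKU : frontier K ⊆ U)
    (hνC1 : ContDiffOn ℝ 1 ν U)
    (hνunit : ∀ x ∈ frontier K, ‖ν x‖ = 1)
    (hνouter : ∀ x ∈ frontier K, ∀ y ∈ K, ⟪y - x, ν x⟫ ≤ 0)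
    (α : ℝ) (hα : 0 < α)
    -- all principal curvatures of `∂K` are at least `α` :
    (hcurv : ∀ x ∈ frontier K, ∀ v ∈ (ℝ ∙ (ν x))ᗮ,
      α * ‖v‖ ^ 2 ≤ ⟪fderiv ℝ ν x v, v⟫)
    (ψ : E n → ℝ) (hψ : ContDiff ℝ 1 ψ)
    (hmean : (∫ x in frontier K, ψ x ∂μH[(n : ℝ) - 1]) = 0) :
    ((n : ℝ) - 1) * α ^ 2 * ∫ x in frontier K, (ψ x) ^ 2 ∂μH[(n : ℝ) - 1]
      ≤ ∫ x in frontier K, ‖tproj (ν x) (gradient ψ x)‖ ^ 2 ∂μH[(n : ℝ) - 1] := by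
  have h : IsSmoothBody K ν U :=
    ⟨hKconv, hKcomp, hKint, hU, hKU, hνC1, hνunit, hνouter⟩
  obtain ⟨c, hc⟩ := exists_volume_eq_lintegral_hausdorffMeasure (n := n) (by omega)
  have hc' : IsSlicing n c := hc
  have hfin : IsFiniteMeasure (surf c K) := h.isFiniteMeasure_surf (by omega) hc'
  have key := h.poincare_surf hn hc' hα hcurv hψ (by
    rw [surf, integral_smul_measure, hmean, smul_zero])
  simp only [surf, integral_smul_measure, smul_eq_mul] at key
  have hc0 : 0 < c.toReal := ENNReal.toReal_pos hc.1 hc.2.1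
  refine le_of_mul_le_mul_left ?_ hc0
  linarith
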